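/- arXiv:math/9404222 — 14 statements merged into one kernel-verified Lean document; each statement's English description precedes it below -/
import Mathlib

section
/- The tangent function satisfies no simple differential equation on the interval (−π/2, π/2): for every n ∈ ℕ and every family of real polynomials p_0, …, p_n that are not all zero, there exists a point x ∈ (−π/2, π/2) such that ∑_{k=0}^n p_k(x)·tan^{(k)}(x) ≠ 0. -/
open Real Finset

/-- The polynomials expressing the iterated derivatives of the tangent through the tangent. -/
noncomputable def tanDerivPoly : ℕ → Polynomial ℝ
  | 0 => Polynomial.X
  | k + 1 => Polynomial.derivative (tanDerivPoly k) * (Polynomial.X ^ 2 + Polynomial.C 1)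

theorem natDegree_tanDerivPoly (k : ℕ) : (tanDerivPoly k).natDegree = k + 1 := by
  induction k with
  | zero => exact Polynomial.natDegree_X
  | succ k ih =>
    have hd : (Polynomial.derivative (tanDerivPoly k)).natDegree = k := by
      rw [Polynomial.natDegree_derivative, ih, Nat.add_sub_cancel]
    have hd0 : Polynomial.derivative (tanDerivPoly k) ≠ 0 := by
      intro h
      have := Polynomial.derivative_eq_zero.mp h
      omega
    have hq : (Polynomial.X ^ 2 + Polynomial.C (1 : ℝ)).natDegree = 2 :=
      Polynomial.natDegree_X_pow_add_C
    have hq0 : Polynomial.X ^ 2 + Polynomial.C (1 : ℝ) ≠ 0 :=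
      Polynomial.ne_zero_of_natDegree_gt (n := 1) (by omega)
    rw [tanDerivPoly, Polynomial.natDegree_mul hd0 hq0, hd, hq]

theorem iteratedDeriv_tan_eq (k : ℕ) {x : ℝ} (hx : cos x ≠ 0) :
    iteratedDeriv k tan x = (tanDerivPoly k).eval (tan x) := by
  induction k generalizing x with
  | zero => simp [tanDerivPoly]
  | succ k ih =>
    have hev : iteratedDeriv k tan =ᶠ[nhds x] (fun t => (tanDerivPoly k).eval t) ∘ tan := by
      filter_upwards [continuous_cos.continuousAt.eventually_ne hx] with y hy using ih hy
    have hsec : 1 / cos x ^ 2 = tan x ^ 2 + 1 := by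
      rw [tan_eq_sin_div_cos]
      field_simp
      exact (sin_sq_add_cos_sq x).symm
    rw [iteratedDeriv_succ, hev.deriv_eq,
      (((tanDerivPoly k).hasDerivAt (tan x)).comp x (hasDerivAt_tan hx)).deriv, hsec]
    simp [tanDerivPoly]

/-- A polynomial of degree at most `N` at `tan x`, with the denominator `cos x ^ N` cleared. -/
theorem cos_pow_mul_eval_tan {N : ℕ} {q : Polynomial ℝ} (hq : q.natDegree ≤ N) {x : ℝ}
    (hx : cos x ≠ 0) :
    cos x ^ N * q.eval (tan x) =
      ∑ j ∈ range (N + 1), q.coeff j * (sin x ^ j * cos x ^ (N - j)) := by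
  rw [Polynomial.eval_eq_sum_range' (Nat.lt_succ_of_le hq), mul_sum]
  refine sum_congr rfl fun j hj => ?_
  have hj : j ≤ N := Nat.lt_succ_iff.mp (mem_range.mp hj)
  rw [tan_eq_sin_div_cos, div_pow, ← pow_sub_mul_pow (cos x) hj]
  field_simp

/-- A polynomial relation between `x` and `tan x` on `(-π/2, π/2)` holds wherever `cos x ≠ 0`. -/
theorem sum_eval_mul_eval_tan_eq_zero {s : Finset ℕ} {p q : ℕ → Polynomial ℝ}
    (h : ∀ x ∈ Set.Ioo (-(π / 2)) (π / 2), ∑ k ∈ s, (p k).eval x * (q k).eval (tan x) = 0)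
    {x : ℝ} (hx : cos x ≠ 0) : ∑ k ∈ s, (p k).eval x * (q k).eval (tan x) = 0 := by
  set N := s.sup fun k => (q k).natDegree
  set F : ℝ → ℝ := fun y => ∑ k ∈ s, (p k).eval y *
    ∑ j ∈ range (N + 1), (q k).coeff j * (sin y ^ j * cos y ^ (N - j)) with hF
  have hcos : ∀ y, cos y ≠ 0 →
      F y = cos y ^ N * ∑ k ∈ s, (p k).eval y * (q k).eval (tan y) := by
    intro y hy
    rw [mul_sum]
    refine sum_congr rfl fun k hk => ?_
    rw [← cos_pow_mul_eval_tan (le_sup (f := fun k => (q k).natDegree) hk) hy]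
    ring
  have hana : AnalyticOnNhd ℝ F Set.univ := by
    refine fun y _ => Finset.analyticAt_fun_sum _ fun k _ => ?_
    refine AnalyticAt.mul ?_ (Finset.analyticAt_fun_sum _ fun j _ => ?_)
    · exact AnalyticAt.aeval_polynomial analyticAt_id (p k)
    · exact analyticAt_const.mul ((analyticAt_sin.pow j).mul (analyticAt_cos.pow _))
  have hzero : F = 0 := by
    refine hana.eq_of_eventuallyEq (z₀ := 0) (fun _ _ => analyticAt_const) ?_
    filter_upwards [Ioo_mem_nhds (neg_lt_zero.mpr pi_div_two_pos) pi_div_two_pos] with y hy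
    rw [hcos y (cos_pos_of_mem_Ioo hy).ne', h y hy, mul_zero, Pi.zero_apply]
  have := hcos x hx
  rw [hzero, Pi.zero_apply] at this
  exact (mul_eq_zero.mp this.symm).resolve_left (pow_ne_zero _ hx)

/-- The tangent is transcendental over the rational functions: a polynomial relation between
`x` and `tan x` on `(-π/2, π/2)` is trivial. -/
theorem sum_eval_mul_eval_eq_zero {s : Finset ℕ} {p q : ℕ → Polynomial ℝ}
    (h : ∀ x ∈ Set.Ioo (-(π / 2)) (π / 2), ∑ k ∈ s, (p k).eval x * (q k).eval (tan x) = 0)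
    (x t : ℝ) : ∑ k ∈ s, (p k).eval x * (q k).eval t = 0 := by
  have hpoly : ∑ k ∈ s, p k * Polynomial.C ((q k).eval t) = 0 := by
    refine Polynomial.eq_zero_of_infinite_isRoot _ (Set.infinite_of_injective_forall_mem
      (f := fun m : ℕ => arctan t + m * π) (fun a b hab => ?_) fun m => ?_)
    · simpa [pi_ne_zero] using hab
    · have hc : cos (arctan t + m * π) ≠ 0 := by
        rw [cos_add_nat_mul_pi]
        exact mul_ne_zero (pow_ne_zero _ (by norm_num)) (cos_arctan_pos t).ne'
      simpa [Polynomial.IsRoot, Polynomial.eval_finsetSum, tan_add_nat_mul_pi, tan_arctan]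
        using sum_eval_mul_eval_tan_eq_zero h hc
  simpa [Polynomial.eval_finsetSum] using congrArg (Polynomial.eval x) hpoly

/-- The polynomials `tanDerivPoly k` are linearly independent, having distinct degrees. -/
theorem eq_zero_of_sum_C_mul_tanDerivPoly {n : ℕ} {c : ℕ → ℝ}
    (h : ∑ k ∈ range n, Polynomial.C (c k) * tanDerivPoly k = 0) : ∀ k < n, c k = 0 := by
  induction n with
  | zero => simp
  | succ n ih =>
    have hn : c n = 0 := by
      have hcoeff := congrArg (Polynomial.coeff · (n + 1)) h
      simp only [Polynomial.finsetSum_coeff, Polynomial.coeff_C_mul, sum_range_succ,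
        Polynomial.coeff_add, Polynomial.coeff_zero] at hcoeff
      rw [sum_eq_zero fun k hk => ?_, zero_add] at hcoeff
      · refine (mul_eq_zero.mp hcoeff).resolve_right ?_
        rw [← natDegree_tanDerivPoly n, Polynomial.coeff_natDegree]
        refine Polynomial.leadingCoeff_ne_zero.mpr
          (Polynomial.ne_zero_of_natDegree_gt (n := 0) ?_)
        rw [natDegree_tanDerivPoly]
        exact n.succ_pos
      · have hk := mem_range.mp hk
        rw [Polynomial.coeff_eq_zero_of_natDegree_lt, mul_zero]
        rw [natDegree_tanDerivPoly]
        omega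
    rw [sum_range_succ, hn, Polynomial.C_0, zero_mul, add_zero] at h
    intro k hk
    rcases Nat.lt_succ_iff_lt_or_eq.mp hk with hk | rfl
    · exact ih h k hk
    · exact hn

theorem tan_not_simple :
    ∀ (n : ℕ) (p : ℕ → Polynomial ℝ), (∃ k ≤ n, p k ≠ 0) →
    ∃ x ∈ Set.Ioo (-(π/2)) (π/2),
      ∑ k ∈ Finset.range (n+1), (p k).eval x * iteratedDeriv k Real.tan x ≠ 0 := by
  rintro n p ⟨k, hk, hpk⟩
  by_contra! hzero
  have h : ∀ x ∈ Set.Ioo (-(π / 2)) (π / 2),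
      ∑ k ∈ range (n + 1), (p k).eval x * (tanDerivPoly k).eval (tan x) = 0 := by
    intro x hx
    rw [← hzero x hx]
    exact sum_congr rfl fun k _ => by
      rw [iteratedDeriv_tan_eq k (cos_pos_of_mem_Ioo hx).ne']
  refine hpk (Polynomial.funext fun x => ?_)
  rw [Polynomial.eval_zero]
  refine eq_zero_of_sum_C_mul_tanDerivPoly (c := fun k => (p k).eval x)
    (Polynomial.funext fun t => ?_) k (Nat.lt_succ_of_le hk)
  simpa [Polynomial.eval_finsetSum] using sum_eval_mul_eval_eq_zero h x t
end

section
/- The secant function satisfies no simple differential equation on the interval (−π/2, π/2): for every n ∈ ℕ and every family of real polynomials p_0, …, p_n that are not all zero, there exists a point x ∈ (−π/2, π/2) such that ∑_{k=0}^n p_k(x)·sec^{(k)}(x) ≠ 0, where sec is the function x ↦ 1/cos x. -/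
open Real Finset

/-- The polynomials `Q` with `sec⁽ᵏ⁾ = Q k (sin) / cos ^ (k + 1)`. -/
noncomputable def secNumerator : ℕ → Polynomial ℝ
  | 0 => 1
  | k + 1 => (1 - Polynomial.X ^ 2) * (secNumerator k).derivative
      + (k + 1 : ℝ) • (Polynomial.X * secNumerator k)

theorem eval_one_secNumerator (k : ℕ) : (secNumerator k).eval 1 = k.factorial := by
  induction k with
  | zero => simp [secNumerator]
  | succ k ih => simp [secNumerator, ih, Nat.factorial_succ]

theorem iteratedDeriv_sec (k : ℕ) {x : ℝ} (hx : Real.cos x ≠ 0) :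
    iteratedDeriv k (fun y => 1 / Real.cos y) x =
      (secNumerator k).eval (Real.sin x) / Real.cos x ^ (k + 1) := by
  induction k generalizing x with
  | zero => simp [secNumerator]
  | succ k ih =>
    have heq : iteratedDeriv k (fun y => 1 / Real.cos y) =ᶠ[nhds x]
        fun y => (secNumerator k).eval (Real.sin y) / Real.cos y ^ (k + 1) := by
      filter_upwards [Real.continuous_cos.continuousAt.eventually_ne hx] with y hy using ih hy
    rw [iteratedDeriv_succ, heq.deriv_eq]
    have hnum : HasDerivAt (fun y => (secNumerator k).eval (Real.sin y)) _ x :=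
      ((secNumerator k).hasDerivAt (Real.sin x)).comp x (Real.hasDerivAt_sin x)
    have hden := (Real.hasDerivAt_cos x).fun_pow (k + 1)
    rw [(hnum.fun_div hden (pow_ne_zero _ hx)).deriv]
    have hsq : 1 - Real.sin x ^ 2 = Real.cos x ^ 2 := by
      linarith [Real.sin_sq_add_cos_sq x]
    simp only [secNumerator, Polynomial.eval_add, Polynomial.eval_mul, Polynomial.eval_sub,
      Polynomial.eval_one, Polynomial.eval_pow, Polynomial.eval_X, Polynomial.eval_smul,
      smul_eq_mul, hsq, Nat.add_sub_cancel, Nat.cast_add, Nat.cast_one]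
    field_simp
    ring

/-- The combination of derivatives of `sec`, multiplied by `cos ^ (n + 1)`, is entire; hence if it
vanishes near the origin it vanishes everywhere. -/
theorem sum_secNumerator_eq_zero (n : ℕ) (p : ℕ → Polynomial ℝ)
    (h : ∀ x ∈ Set.Ioo (-(π / 2)) (π / 2), ∑ k ∈ Finset.range (n + 1),
      (p k).eval x * iteratedDeriv k (fun y => 1 / Real.cos y) x = 0) (x : ℝ) :
    ∑ k ∈ Finset.range (n + 1),
      (p k).eval x * (secNumerator k).eval (Real.sin x) * Real.cos x ^ (n - k) = 0 := by
  have hpoly (q : Polynomial ℝ) : AnalyticOnNhd ℝ (fun y => q.eval y) Set.univ :=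
    AnalyticOnNhd.eval_polynomial q
  have hF : AnalyticOnNhd ℝ (fun y => ∑ k ∈ Finset.range (n + 1),
      (p k).eval y * (secNumerator k).eval (Real.sin y) * Real.cos y ^ (n - k)) Set.univ := by
    refine Finset.analyticOnNhd_fun_sum _ fun k _ y _ => ?_
    exact (((hpoly (p k)) y trivial).mul
      (((hpoly (secNumerator k)) _ trivial).comp Real.analyticAt_sin)).mul
      (Real.analyticAt_cos.pow _)
  refine congrFun (hF.eq_of_eventuallyEq (g := fun _ => 0) analyticOnNhd_const (z₀ := 0) ?_) x
  filter_upwards [Ioo_mem_nhds (neg_lt_zero.mpr pi_div_two_pos) pi_div_two_pos] with y hy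
  have hcos : Real.cos y ≠ 0 := (Real.cos_pos_of_mem_Ioo hy).ne'
  have hmul := congrArg (· * Real.cos y ^ (n + 1)) (h y hy)
  simp only [zero_mul, Finset.sum_mul] at hmul
  rw [← hmul]
  refine Finset.sum_congr rfl fun k hk => ?_
  have hkn : n + 1 = (n - k) + (k + 1) := by have := Finset.mem_range.mp hk; omega
  rw [iteratedDeriv_sec k hcos, hkn, pow_add _ (n - k)]
  field_simp

theorem leading_coeff_eq_zero_of_sec (n : ℕ) (p : ℕ → Polynomial ℝ)
    (h : ∀ x ∈ Set.Ioo (-(π / 2)) (π / 2), ∑ k ∈ Finset.range (n + 1),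
      (p k).eval x * iteratedDeriv k (fun y => 1 / Real.cos y) x = 0) : p n = 0 := by
  refine Polynomial.eq_zero_of_infinite_isRoot _ ?_
  refine Set.infinite_of_injective_forall_mem (f := fun m : ℕ => π / 2 + m * (2 * π)) ?_ ?_
  · intro a b hab
    simpa [pi_ne_zero] using hab
  · intro m
    have hsum := sum_secNumerator_eq_zero n p h (π / 2 + m * (2 * π))
    have hlower : ∀ k ∈ Finset.range n, (p k).eval (π / 2 + m * (2 * π)) *
        (secNumerator k).eval 1 * (0 : ℝ) ^ (n - k) = 0 := fun k hk => by
      rw [zero_pow (Nat.sub_ne_zero_of_lt (Finset.mem_range.mp hk)), mul_zero]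
    rw [Real.sin_add_nat_mul_two_pi, Real.cos_add_nat_mul_two_pi, Real.sin_pi_div_two,
      Real.cos_pi_div_two, Finset.sum_range_succ, Finset.sum_eq_zero hlower,
      eval_one_secNumerator] at hsum
    simpa [Nat.factorial_ne_zero] using hsum

theorem sec_not_simple :
    ∀ (n : ℕ) (p : ℕ → Polynomial ℝ), (∃ k ≤ n, p k ≠ 0) →
    ∃ x ∈ Set.Ioo (-(π/2)) (π/2),
      ∑ k ∈ Finset.range (n+1),
        (p k).eval x * iteratedDeriv k (fun y => 1 / Real.cos y) x ≠ 0 := by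
  intro n p
  contrapose!
  intro h
  induction n with
  | zero =>
    intro k hk
    rw [Nat.le_zero.mp hk]
    exact leading_coeff_eq_zero_of_sec 0 p h
  | succ n ih =>
    have hlead := leading_coeff_eq_zero_of_sec (n + 1) p h
    intro k hk
    rcases Nat.le_succ_iff.mp hk with hk | rfl
    · refine ih (fun x hx => ?_) k hk
      simpa [Finset.sum_range_succ _ (n + 1), hlead] using h x hx
    · exact hlead
end

section
/- The Bernoulli numbers satisfy no finite homogeneous linear recurrence equation with polynomial coefficients: there do not exist N ∈ ℕ and rational polynomials q_0, …, q_N, not all zero, such that ∑_{j=0}^N q_j(k)·B_{k+j} = 0 holds for every k ∈ ℕ. -/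
open Finset

/-- The local form of the von Staudt–Clausen theorem: `B_{2k}` agrees up to a `p`-integral number
with `-1/p` if `p - 1 ∣ 2k`, and with `0` otherwise. -/
theorem padicNorm_bernoulli_add_ite_le_one {p : ℕ} [hp : Fact p.Prime] {k : ℕ} (hk : 0 < k) :
    padicNorm p (bernoulli (2 * k) + if (p - 1) ∣ 2 * k then (1 : ℚ) / p else 0) ≤ 1 := by
  obtain ⟨z, hz⟩ := Bernoulli.vonStaudt_clausen k
  set s := {q ∈ range (2 * k + 2) | q.Prime ∧ (q - 1) ∣ 2 * k}
  have hsplit : ∑ q ∈ s, (1 : ℚ) / q =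
      (if (p - 1) ∣ 2 * k then (1 : ℚ) / p else 0) + ∑ q ∈ s.erase p, (1 : ℚ) / q := by
    split_ifs with hd
    · refine (Finset.add_sum_erase s _ ?_).symm
      have := Nat.le_of_dvd (by lia) hd
      exact mem_filter.mpr ⟨mem_range.mpr (by lia), hp.out, hd⟩
    · rw [Finset.erase_eq_of_notMem fun h ↦ hd (mem_filter.mp h).2.2, zero_add]
  have hrest : padicNorm p (∑ q ∈ s.erase p, (1 : ℚ) / q) ≤ 1 := by
    refine padicNorm.sum_le' (fun q hq ↦ ?_) zero_le_one
    obtain ⟨hne, hqs⟩ := mem_erase.mp hq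
    have : Fact q.Prime := ⟨(mem_filter.mp hqs).2.1⟩
    rw [padicNorm.div, padicNorm.one, padicNorm.padicNorm_of_prime_of_ne hne.symm, div_one]
  rw [hsplit, ← add_assoc] at hz
  rw [eq_sub_of_add_eq hz.symm]
  exact padicNorm.sub.trans (max_le (padicNorm.of_int z) hrest)

theorem padicNorm_bernoulli_le_one {p n : ℕ} [hp : Fact p.Prime] (hp2 : p ≠ 2)
    (hn : ¬ (p - 1) ∣ n) : padicNorm p (bernoulli n) ≤ 1 := by
  obtain ⟨k, rfl⟩ | hodd := n.even_or_odd
  · rw [← two_mul] at hn ⊢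
    have hk : 0 < k := Nat.pos_of_ne_zero fun h ↦ hn (by simp [h])
    simpa [hn] using padicNorm_bernoulli_add_ite_le_one (p := p) hk
  · obtain rfl | h1 := eq_or_ne n 1
    · have : Fact (Nat.Prime 2) := ⟨Nat.prime_two⟩
      have h2 : padicNorm p ((2 : ℕ) : ℚ) = 1 := padicNorm.padicNorm_of_prime_of_ne hp2
      rw [bernoulli_one, padicNorm.div, padicNorm.neg, padicNorm.one,
        show (2 : ℚ) = (2 : ℕ) from rfl, h2, div_one]
    · rw [bernoulli_eq_zero_of_odd hodd (by have := hodd.pos; lia), padicNorm.zero]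
      exact zero_le_one

theorem one_lt_padicNorm_bernoulli {p k : ℕ} [hp : Fact p.Prime] (hk : 0 < k)
    (hd : (p - 1) ∣ 2 * k) : 1 < padicNorm p (bernoulli (2 * k)) := by
  by_contra! h
  have hint := padicNorm_bernoulli_add_ite_le_one (p := p) hk
  rw [if_pos hd] at hint
  have hinv := (padicNorm.sub (p := p)).trans (max_le hint h)
  rw [add_sub_cancel_left, padicNorm.div, padicNorm.one, padicNorm.padicNorm_p_of_prime,
    one_div, inv_inv] at hinv
  exact hinv.not_gt (mod_cast hp.out.one_lt)

theorem Polynomial.exists_intCast_mul_eval_eq (q : Polynomial ℚ) :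
    ∃ (D : ℤ) (P : Polynomial ℤ), D ≠ 0 ∧ ∀ a : ℤ, D * q.eval (a : ℚ) = P.eval a := by
  obtain ⟨D, hD, hP⟩ := IsLocalization.integerNormalization_spec (nonZeroDivisors ℤ) q
  refine ⟨D, IsLocalization.integerNormalization (nonZeroDivisors ℤ) q,
    nonZeroDivisors.ne_zero hD, fun a ↦ ?_⟩
  have := congrArg (Polynomial.eval (a : ℚ)) hP
  rw [← eq_intCast (algebraMap ℤ ℚ) a, Polynomial.eval_map_apply, Polynomial.eval_smul] at this
  simpa using this.symm

/-- For all large primes `p`, a rational polynomial takes `p`-integral values at integers and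
preserves congruences modulo `p`. -/
theorem Polynomial.eventually_padicNorm_eval (q : Polynomial ℚ) :
    ∀ᶠ p : ℕ in Filter.atTop, p.Prime →
      (∀ a : ℤ, padicNorm p (q.eval (a : ℚ)) ≤ 1) ∧
      ∀ a b : ℤ, (p : ℤ) ∣ a - b → padicNorm p (q.eval (a : ℚ) - q.eval (b : ℚ)) < 1 := by
  obtain ⟨D, P, hD, hP⟩ := q.exists_intCast_mul_eval_eq
  filter_upwards [Filter.eventually_gt_atTop D.natAbs] with p hpD hp
  have : Fact p.Prime := ⟨hp⟩
  have hDp : padicNorm p D = 1 :=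
    (padicNorm.int_eq_one_iff D).mpr fun h ↦
      hD (Int.eq_zero_of_dvd_of_natAbs_lt_natAbs h (by simpa using hpD))
  have hmul (x : ℚ) : padicNorm p x = padicNorm p (D * x) := by
    rw [padicNorm.mul, hDp, one_mul]
  refine ⟨fun a ↦ ?_, fun a b hab ↦ ?_⟩
  · rw [hmul, hP]
    exact padicNorm.of_int _
  · rw [hmul, mul_sub, hP, hP, ← Int.cast_sub, padicNorm.int_lt_one_iff]
    exact hab.trans (P.sub_dvd_eval_sub a b)

theorem eq_zero_of_frequently_padicNorm_lt_one {x : ℚ}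
    (h : ∃ᶠ p : ℕ in Filter.atTop, p.Prime ∧ padicNorm p x < 1) : x = 0 := by
  obtain ⟨p, ⟨hp, hx⟩, hlt⟩ := (h.and_eventually (Filter.eventually_gt_atTop x.num.natAbs)).exists
  have : Fact p.Prime := ⟨hp⟩
  have hnum : padicNorm p (x.num : ℚ) < 1 := by
    rw [← Rat.mul_den_eq_num, padicNorm.mul]
    exact (mul_le_of_le_one_right (padicNorm.nonneg _) (padicNorm.of_nat _)).trans_lt hx
  rw [padicNorm.int_lt_one_iff] at hnum
  exact Rat.num_eq_zero.mp (Int.eq_zero_of_dvd_of_natAbs_lt_natAbs hnum (by simpa using hlt))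

theorem Nat.not_dvd_mul_sub_add {m N r i j : ℕ} (hm : N < m) (hr : 0 < r) (hi : i ≤ N)
    (hj : j ≤ N) (hij : i ≠ j) : ¬ m ∣ r * m - j + i := by
  intro h
  have hle : j ≤ r * m := by nlinarith
  have h' : (m : ℤ) ∣ i - j := by
    have := Int.natCast_dvd_natCast.mpr h
    push_cast [hle] at this
    simpa [sub_add_eq_add_sub, add_sub_assoc] using this
  have := Int.eq_zero_of_dvd_of_natAbs_lt_natAbs h' (by lia)
  lia

/-- In a recurrence for the Bernoulli numbers evaluated at `k = r(p - 1) - j`, the only term whose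
Bernoulli number is not `p`-integral is the `j`-th one, so its coefficient is divisible by `p`. -/
theorem padicNorm_eval_lt_one_of_recurrence {N : ℕ} {q : ℕ → Polynomial ℚ}
    (h : ∀ k : ℕ, ∑ j ∈ range (N + 1), (q j).eval (k : ℚ) * bernoulli (k + j) = 0)
    {p r j : ℕ} [hp : Fact p.Prime] (hpN : N + 2 < p) (hr : 0 < r) (hj : j ≤ N)
    (hq : ∀ i ≤ N, ∀ a : ℤ, padicNorm p ((q i).eval (a : ℚ)) ≤ 1) :
    padicNorm p ((q j).eval ((r * (p - 1) - j : ℕ) : ℚ)) < 1 := by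
  set k := r * (p - 1) - j with hk
  have hle : j ≤ r * (p - 1) := by
    calc j ≤ p - 1 := by lia
      _ ≤ r * (p - 1) := Nat.le_mul_of_pos_left _ hr
  have hp2 : p ≠ 2 := by lia
  obtain ⟨c, hc⟩ := hp.out.even_sub_one hp2
  have hkj : k + j = 2 * (r * c) := by
    rw [hk, Nat.sub_add_cancel hle, hc]; ring
  have hlarge : 1 < padicNorm p (bernoulli (k + j)) := by
    rw [hkj]
    refine one_lt_padicNorm_bernoulli (Nat.mul_pos hr (by lia)) ?_
    rw [← hkj, hk, Nat.sub_add_cancel hle]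
    exact dvd_mul_left _ _
  have hrest : padicNorm p (∑ i ∈ (range (N + 1)).erase j,
      (q i).eval (k : ℚ) * bernoulli (k + i)) ≤ 1 := by
    refine padicNorm.sum_le' (fun i hi ↦ ?_) zero_le_one
    obtain ⟨hij, hi⟩ := mem_erase.mp hi
    have hiN : i ≤ N := by simpa [Nat.lt_succ_iff] using hi
    rw [padicNorm.mul]
    exact mul_le_one₀ (mod_cast hq i hiN k) (padicNorm.nonneg _)
      (padicNorm_bernoulli_le_one hp2 (Nat.not_dvd_mul_sub_add (by lia) hr hiN hj hij))
  have hsum := h k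
  rw [← Finset.add_sum_erase _ _ (mem_range.mpr (Nat.lt_succ_of_le hj))] at hsum
  have hterm : padicNorm p ((q j).eval (k : ℚ)) * padicNorm p (bernoulli (k + j)) ≤ 1 := by
    rwa [← padicNorm.mul, eq_neg_of_add_eq_zero_left hsum, padicNorm.neg]
  by_contra! hge
  nlinarith

theorem bernoulli_no_polynomial_recurrence :
    ¬ ∃ (N : ℕ) (q : ℕ → Polynomial ℚ), (∃ j ≤ N, q j ≠ 0) ∧
      ∀ k : ℕ, ∑ j ∈ Finset.range (N+1), (q j).eval (k : ℚ) * bernoulli (k + j) = 0 := by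
  rintro ⟨N, q, ⟨j, hj, hqj⟩, h⟩
  have hgood := (Finset.eventually_all (range (N + 1))).mpr
    fun i _ ↦ (q i).eventually_padicNorm_eval
  have hroot (r : ℕ) (hr : 0 < r) : (q j).eval ((-r - j : ℤ) : ℚ) = 0 := by
    refine eq_zero_of_frequently_padicNorm_lt_one ?_
    refine ((Nat.frequently_atTop_iff_infinite.mpr Nat.infinite_setOfPred_prime).and_eventually
      (hgood.and (Filter.eventually_gt_atTop (N + 2)))).mono ?_
    rintro p ⟨hp, hgp, hpN⟩
    have : Fact p.Prime := ⟨hp⟩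
    refine ⟨hp, ?_⟩
    have hlt := padicNorm_eval_lt_one_of_recurrence h hpN hr hj
      fun i hi ↦ (hgp i (mem_range.mpr (Nat.lt_succ_of_le hi)) hp).1
    have hcong := (hgp j (mem_range.mpr (Nat.lt_succ_of_le hj)) hp).2
      (r * (p - 1) - j : ℕ) (-r - j) ⟨r, by
        have hle : j ≤ r * (p - 1) := by
          calc j ≤ p - 1 := by lia
            _ ≤ r * (p - 1) := Nat.le_mul_of_pos_left _ hr
        push_cast [hle, hp.one_le]
        ring⟩
    rw [Int.cast_natCast] at hcong
    have := (padicNorm.sub (p := p)).trans_lt (max_lt hlt hcong)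
    rwa [sub_sub_cancel] at this
  refine hqj (Polynomial.eq_zero_of_infinite_isRoot _ (Set.infinite_of_injective_forall_mem
    (f := fun r : ℕ ↦ ((-(r + 1 : ℕ) - j : ℤ) : ℚ)) (fun a b hab ↦ ?_) fun r ↦ hroot _ r.succ_pos))
  simpa using hab
end

section
/- Let f : ℝ → ℝ be smooth, let q ∈ ℕ with q ≥ 2, and define h : ℝ → ℝ by h(x) = f(x^{1/q}). Then for every r ∈ ℕ with 1 ≤ r ≤ q−1 there exist real constants C_1, …, C_r with C_1 = q·(q−1)⋯(q−r+1) (the product of the r factors q, q−1, …, q−r+1) and C_r = q^r, such that for every x > 0: x^{r/q}·f^{(r)}(x^{1/q}) = ∑_{k=1}^r C_k·x^k·h^{(k)}(x). -/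
open Real Finset

/-- Coefficients of the expansion of `x ^ (r / q) * f⁽ʳ⁾ (x ^ (1 / q))` in terms of the functions
`x ^ k * h⁽ᵏ⁾ x`, where `h x = f (x ^ (1 / q))`. -/
def rootCoeff (q : ℝ) : ℕ → ℕ → ℝ
  | 0, 0 => 1
  | 0, _ + 1 => 0
  | r + 1, 0 => -r * rootCoeff q r 0
  | r + 1, k + 1 => (q * (k + 1) - r) * rootCoeff q r (k + 1) + q * rootCoeff q r k

theorem rootCoeff_succ_zero (q : ℝ) (r : ℕ) : rootCoeff q (r + 1) 0 = 0 := by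
  induction r with
  | zero => simp [rootCoeff]
  | succ r ih => rw [rootCoeff, ih, mul_zero]

theorem rootCoeff_of_lt (q : ℝ) {r k : ℕ} (hk : r < k) : rootCoeff q r k = 0 := by
  induction r generalizing k with
  | zero => obtain _ | k := k <;> simp_all [rootCoeff]
  | succ r ih =>
    obtain _ | k := k
    · omega
    · rw [rootCoeff, ih (by omega), ih (by omega), mul_zero, mul_zero, add_zero]

theorem rootCoeff_self (q : ℝ) (r : ℕ) : rootCoeff q r r = q ^ r := by
  induction r with
  | zero => simp [rootCoeff]
  | succ r ih => rw [rootCoeff, rootCoeff_of_lt q r.lt_succ_self, ih]; ring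

theorem rootCoeff_succ_one (q : ℝ) (r : ℕ) :
    rootCoeff q (r + 1) 1 = ∏ i ∈ range (r + 1), (q - i) := by
  induction r with
  | zero => simp [rootCoeff]
  | succ r ih =>
    rw [rootCoeff, prod_range_succ, ← ih, rootCoeff_succ_zero]
    push_cast
    ring

theorem sum_rootCoeff_succ (q x : ℝ) (r : ℕ) (u : ℕ → ℝ) :
    ∑ k ∈ range (r + 2), rootCoeff q (r + 1) k * x ^ k * u k =
      q * x * ∑ k ∈ range (r + 1),
        rootCoeff q r k * (k * x ^ (k - 1) * u k + x ^ k * u (k + 1)) -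
      r * ∑ k ∈ range (r + 1), rootCoeff q r k * x ^ k * u k := by
  have hshift : ∑ k ∈ range (r + 1), (q * (k + 1 : ℕ) - r) * rootCoeff q r (k + 1) *
      x ^ (k + 1) * u (k + 1) + (q * (0 : ℕ) - r) * rootCoeff q r 0 * x ^ 0 * u 0 =
      ∑ k ∈ range (r + 1), (q * k - r) * rootCoeff q r k * x ^ k * u k := by
    rw [← sum_range_succ' (fun k : ℕ ↦ (q * k - r) * rootCoeff q r k * x ^ k * u k),
      sum_range_succ _ (r + 1), rootCoeff_of_lt q r.lt_succ_self]
    ring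
  have hpow (k : ℕ) : x * (k * x ^ (k - 1)) = k * x ^ k := by
    obtain _ | k := k
    · simp
    · rw [Nat.add_sub_cancel]; ring
  calc _ = (∑ k ∈ range (r + 1), (q * (k + 1 : ℕ) - r) * rootCoeff q r (k + 1) *
      x ^ (k + 1) * u (k + 1) + (q * (0 : ℕ) - r) * rootCoeff q r 0 * x ^ 0 * u 0) +
      ∑ k ∈ range (r + 1), q * rootCoeff q r k * x ^ (k + 1) * u (k + 1) := by
        rw [sum_range_succ', add_right_comm, ← sum_add_distrib]
        congr 1
        · refine sum_congr rfl fun k _ ↦ ?_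
          rw [rootCoeff]
          push_cast
          ring
        · rw [rootCoeff]
          simp
    _ = _ := by
        rw [hshift, mul_sum, mul_sum, ← sum_add_distrib, ← sum_sub_distrib]
        refine sum_congr rfl fun k _ ↦ ?_
        linear_combination (-q * rootCoeff q r k * u k) * hpow k

theorem ContDiffAt.hasDerivAt_iteratedDeriv {g : ℝ → ℝ} {x : ℝ} {n : WithTop ℕ∞} {k : ℕ}
    (hg : ContDiffAt ℝ n g x) (hk : k < n) :
    HasDerivAt (iteratedDeriv k g) (iteratedDeriv (k + 1) g x) x := by
  rw [iteratedDeriv_succ, iteratedDeriv_eq_equiv_comp]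
  refine DifferentiableAt.hasDerivAt ?_
  rw [LinearIsometryEquiv.comp_differentiableAt_iff]
  exact hg.differentiableAt_iteratedFDeriv hk

theorem hasDerivAt_rpow_mul_comp_rpow {g : ℝ → ℝ} {g' a b x : ℝ} (hx : 0 < x)
    (hg : HasDerivAt g g' (x ^ b)) :
    HasDerivAt (fun y ↦ y ^ a * g (y ^ b))
      (x⁻¹ * (a * (x ^ a * g (x ^ b)) + b * (x ^ (a + b) * g'))) x := by
  have hpow (c : ℝ) : HasDerivAt (fun y : ℝ ↦ y ^ c) (c * x ^ (c - 1)) x :=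
    Real.hasDerivAt_rpow_const (Or.inl hx.ne')
  refine ((hpow a).mul (hg.comp x (hpow b))).congr_deriv ?_
  rw [Real.rpow_sub_one hx.ne', Real.rpow_sub_one hx.ne', Real.rpow_add hx]
  simp only [Function.comp_apply]
  ring

theorem rpow_mul_iteratedDeriv_comp_rpow_eq_sum {f : ℝ → ℝ} (hf : ContDiff ℝ (⊤ : ℕ∞) f)
    {q : ℝ} (hq : q ≠ 0) (r : ℕ) {x : ℝ} (hx : 0 < x) :
    x ^ (r / q) * iteratedDeriv r f (x ^ (1 / q)) =
      ∑ k ∈ range (r + 1),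
        rootCoeff q r k * x ^ k * iteratedDeriv k (fun y ↦ f (y ^ (1 / q))) x := by
  induction r generalizing x with
  | zero => simp [rootCoeff]
  | succ r ih =>
    have hh : ContDiffAt ℝ (⊤ : ℕ∞) (fun y ↦ f (y ^ (1 / q))) x :=
      hf.contDiffAt.comp x (Real.contDiffAt_rpow_const_of_ne hx.ne')
    have hlt (k : ℕ) : (k : WithTop ℕ∞) < (⊤ : ℕ∞) := mod_cast ENat.natCast_lt_top k
    have hleft := hasDerivAt_rpow_mul_comp_rpow (a := r / q) (b := 1 / q) hx
      (hf.contDiffAt.hasDerivAt_iteratedDeriv (hlt r))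
    have hright := HasDerivAt.fun_sum (u := range (r + 1)) fun k _ ↦
      ((hasDerivAt_pow k x).fun_mul (hh.hasDerivAt_iteratedDeriv (hlt k))).const_mul
        (rootCoeff q r k)
    have heq := hleft.unique (hright.congr_of_eventuallyEq (by
      filter_upwards [lt_mem_nhds hx] with y hy
      simpa only [mul_assoc] using ih hy))
    rw [sum_rootCoeff_succ, ← ih hx, ← heq, Nat.cast_succ, add_div]
    field_simp
    ring

theorem lemma_1q_a_part1 (f : ℝ → ℝ) (hf : ContDiff ℝ (⊤ : ℕ∞) f) (q : ℕ) (hq : 2 ≤ q)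
    (h : ℝ → ℝ) (hh : ∀ x : ℝ, h x = f (x ^ (1 / (q : ℝ)))) :
    ∀ r : ℕ, 1 ≤ r → r ≤ q - 1 →
      ∃ C : ℕ → ℝ, C 1 = (∏ i ∈ Finset.range r, ((q : ℝ) - i)) ∧ C r = (q : ℝ) ^ r ∧
        ∀ x : ℝ, 0 < x →
          x ^ ((r : ℝ) / q) * iteratedDeriv r f (x ^ (1 / (q : ℝ))) =
            ∑ k ∈ Finset.Icc 1 r, C k * x ^ k * iteratedDeriv k h x := by
  intro r hr _
  obtain ⟨r, rfl⟩ := Nat.exists_eq_add_of_le' hr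
  refine ⟨rootCoeff q (r + 1), rootCoeff_succ_one _ _, rootCoeff_self _ _, fun x hx ↦ ?_⟩
  have hq0 : (q : ℝ) ≠ 0 := by positivity
  rw [rpow_mul_iteratedDeriv_comp_rpow_eq_sum hf hq0 _ hx, ← funext hh, range_eq_Ico,
    sum_eq_sum_Ico_succ_bot (by omega), rootCoeff_succ_zero, zero_mul, zero_mul, zero_add]
  rfl
end

section
/- Let f : ℝ → ℝ be smooth, let q ∈ ℕ with q ≥ 2, and define h : ℝ → ℝ by h(x) = f(x^{1/q}). Then there exist real constants C_1, …, C_q with C_1 = q! and C_q = q^q, such that for every x > 0: f^{(q)}(x^{1/q}) = ∑_{k=1}^q C_k·x^{k−1}·h^{(k)}(x). -/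
open Real Finset

/-- The coefficient of `y ^ (q * k - n) * h⁽ᵏ⁾(y ^ q)` in the `n`-th derivative of
`y ↦ h (y ^ q)`. -/
noncomputable def powCompCoeff (q : ℕ) : ℕ → ℕ → ℝ
  | 0, 0 => 1
  | 0, _ + 1 => 0
  | n + 1, 0 => -n * powCompCoeff q n 0
  | n + 1, k + 1 =>
    ((q : ℝ) * (k + 1) - n) * powCompCoeff q n (k + 1) + q * powCompCoeff q n k

lemma powCompCoeff_eq_zero_of_lt (q : ℕ) {n k : ℕ} (hnk : n < k) : powCompCoeff q n k = 0 := by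
  induction n generalizing k with
  | zero =>
    obtain ⟨k, rfl⟩ := Nat.exists_eq_succ_of_ne_zero hnk.ne'
    rfl
  | succ n ih =>
    obtain ⟨k, rfl⟩ := Nat.exists_eq_succ_of_ne_zero (Nat.ne_of_gt (Nat.zero_lt_of_lt hnk))
    simp [powCompCoeff, ih (show n < k + 1 by lia), ih (show n < k by lia)]

lemma powCompCoeff_self (q n : ℕ) : powCompCoeff q n n = (q : ℝ) ^ n := by
  induction n with
  | zero => simp [powCompCoeff]
  | succ n ih =>
    simp [powCompCoeff, ih, powCompCoeff_eq_zero_of_lt q (Nat.lt_succ_self n), pow_succ']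

lemma powCompCoeff_succ_zero (q n : ℕ) : powCompCoeff q (n + 1) 0 = 0 := by
  induction n with
  | zero => simp [powCompCoeff]
  | succ n ih => rw [powCompCoeff, ih, mul_zero]

lemma powCompCoeff_succ_one (q n : ℕ) :
    powCompCoeff q (n + 1) 1 = (q.descFactorial (n + 1) : ℝ) := by
  induction n with
  | zero => simp [powCompCoeff]
  | succ n ih =>
    rw [powCompCoeff, zero_add, ih, powCompCoeff_succ_zero, Nat.descFactorial_succ q (n + 1)]
    rcases le_or_gt (n + 1) q with hn | hn
    · push_cast [Nat.cast_sub hn]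
      ring
    · rw [Nat.descFactorial_of_lt hn]
      simp

lemma ContDiffAt.hasDerivAt_iteratedDeriv_s4 {h : ℝ → ℝ} {x : ℝ}
    (hx : ContDiffAt ℝ (⊤ : ℕ∞) h x) (k : ℕ) :
    HasDerivAt (iteratedDeriv k h) (iteratedDeriv (k + 1) h x) x := by
  rw [iteratedDeriv_succ]
  refine DifferentiableAt.hasDerivAt ?_
  rw [← differentiableWithinAt_univ, ← iteratedDerivWithin_univ]
  exact (contDiffWithinAt_univ.2 hx).differentiableWithinAt_iteratedDerivWithin
    (by exact_mod_cast WithTop.coe_lt_top k) (by simp)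

/-- A Faà di Bruno type formula for `f y = h (y ^ q)` on the positive half-line. -/
lemma iteratedDeriv_eq_sum_powCompCoeff {f h : ℝ → ℝ} {q : ℕ} (hq : q ≠ 0)
    (hfh : ∀ y, 0 < y → f y = h (y ^ q))
    (hh : ∀ x, 0 < x → ContDiffAt ℝ (⊤ : ℕ∞) h x) (n : ℕ) {y : ℝ} (hy : 0 < y) :
    iteratedDeriv n f y = ∑ k ∈ range (n + 1),
      powCompCoeff q n k * y ^ ((q : ℤ) * k - n) * iteratedDeriv k h (y ^ q) := by
  induction n generalizing y with
  | zero => simp [powCompCoeff, hfh y hy]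
  | succ n ih =>
    have hev : iteratedDeriv n f =ᶠ[nhds y] fun y ↦ ∑ k ∈ range (n + 1),
        powCompCoeff q n k * y ^ ((q : ℤ) * k - n) * iteratedDeriv k h (y ^ q) := by
      filter_upwards [lt_mem_nhds hy] with z hz using ih hz
    have hd : ∀ k : ℕ, HasDerivAt
        (fun y : ℝ ↦ powCompCoeff q n k * y ^ ((q : ℤ) * k - n) * iteratedDeriv k h (y ^ q))
        (((q : ℝ) * k - n) * powCompCoeff q n k * y ^ ((q : ℤ) * k - (n + 1 : ℕ)) *
            iteratedDeriv k h (y ^ q) +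
          q * powCompCoeff q n k * y ^ ((q : ℤ) * (k + 1 : ℕ) - (n + 1 : ℕ)) *
            iteratedDeriv (k + 1) h (y ^ q)) y := by
      intro k
      have h1 := (hasDerivAt_zpow ((q : ℤ) * k - n) y (Or.inl hy.ne')).const_mul
        (powCompCoeff q n k)
      have h2 : HasDerivAt (fun y ↦ iteratedDeriv k h (y ^ q))
          (iteratedDeriv (k + 1) h (y ^ q) * (q * y ^ (q - 1))) y :=
        ((hh (y ^ q) (by positivity)).hasDerivAt_iteratedDeriv_s4 k).comp y (hasDerivAt_pow q y)
      refine (h1.mul h2).congr_deriv ?_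
      have e1 : (q : ℤ) * k - (n + 1 : ℕ) = (q : ℤ) * k - n - 1 := by push_cast; ring
      have e2 : y ^ ((q : ℤ) * (k + 1 : ℕ) - (n + 1 : ℕ)) =
          y ^ ((q : ℤ) * k - n) * y ^ (q - 1) := by
        rw [← zpow_natCast y (q - 1), ← zpow_add₀ hy.ne']
        congr 1
        push_cast [Nat.cast_sub (Nat.one_le_iff_ne_zero.2 hq)]
        ring
      rw [e1, e2]
      push_cast
      ring
    rw [iteratedDeriv_succ, hev.deriv_eq, (HasDerivAt.fun_sum fun k _ ↦ hd k).deriv,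
      sum_add_distrib, sum_range_succ' _ (n + 1)]
    have hshift : ∑ k ∈ range (n + 1), ((q : ℝ) * k - n) * powCompCoeff q n k *
          y ^ ((q : ℤ) * k - (n + 1 : ℕ)) * iteratedDeriv k h (y ^ q) =
        ∑ k ∈ range (n + 1), ((q : ℝ) * (k + 1 : ℕ) - n) * powCompCoeff q n (k + 1) *
          y ^ ((q : ℤ) * (k + 1 : ℕ) - (n + 1 : ℕ)) * iteratedDeriv (k + 1) h (y ^ q) +
        ((q : ℝ) * (0 : ℕ) - n) * powCompCoeff q n 0 *
          y ^ ((q : ℤ) * (0 : ℕ) - (n + 1 : ℕ)) * iteratedDeriv 0 h (y ^ q) := by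
      rw [← sum_range_succ' (fun k : ℕ ↦ ((q : ℝ) * k - n) * powCompCoeff q n k *
          y ^ ((q : ℤ) * k - (n + 1 : ℕ)) * iteratedDeriv k h (y ^ q)) (n + 1),
        sum_range_succ _ (n + 1), powCompCoeff_eq_zero_of_lt q (Nat.lt_succ_self n)]
      ring
    rw [hshift, add_right_comm, ← sum_add_distrib]
    congr 1
    · refine sum_congr rfl fun k _ ↦ ?_
      rw [powCompCoeff]
      push_cast
      ring
    · rw [powCompCoeff]
      push_cast
      ring

theorem lemma_1q_a_part2 (f : ℝ → ℝ) (hf : ContDiff ℝ (⊤ : ℕ∞) f) (q : ℕ) (hq : 2 ≤ q)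
    (h : ℝ → ℝ) (hh : ∀ x : ℝ, h x = f (x ^ (1 / (q : ℝ)))) :
    ∃ C : ℕ → ℝ, C 1 = (Nat.factorial q : ℝ) ∧ C q = (q : ℝ) ^ q ∧
      ∀ x : ℝ, 0 < x →
        iteratedDeriv q f (x ^ (1 / (q : ℝ))) =
          ∑ k ∈ Finset.Icc 1 q, C k * x ^ (k - 1) * iteratedDeriv k h x := by
  have hq0 : q ≠ 0 := by lia
  obtain ⟨p, hp⟩ := Nat.exists_eq_succ_of_ne_zero hq0
  refine ⟨powCompCoeff q q, ?_, powCompCoeff_self q q, fun x hx ↦ ?_⟩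
  · have := powCompCoeff_succ_one q p
    rwa [← Nat.succ_eq_add_one, ← hp, Nat.descFactorial_self] at this
  have hfh : ∀ y, 0 < y → f y = h (y ^ q) := fun y hy ↦ by
    rw [hh, one_div, Real.pow_rpow_inv_natCast hy.le hq0]
  have hsmooth : ∀ x, 0 < x → ContDiffAt ℝ (⊤ : ℕ∞) h x := fun x hx ↦ by
    rw [funext hh]
    exact hf.contDiffAt.comp x (Real.contDiffAt_rpow_const_of_ne hx.ne')
  set y := x ^ (1 / (q : ℝ)) with hy
  have hypos : 0 < y := Real.rpow_pos_of_pos hx _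
  have hyx : y ^ q = x := by rw [hy, one_div, Real.rpow_inv_natCast_pow hx.le hq0]
  have hzero : powCompCoeff q q 0 = 0 := by
    have := powCompCoeff_succ_zero q p
    rwa [← Nat.succ_eq_add_one, ← hp] at this
  rw [iteratedDeriv_eq_sum_powCompCoeff hq0 hfh hsmooth q hypos, sum_range_succ', hzero,
    range_eq_Ico, sum_Ico_add' (fun k : ℕ ↦ powCompCoeff q q k * y ^ ((q : ℤ) * k - q) *
      iteratedDeriv k h (y ^ q)) 0 q 1, zero_mul, zero_mul, add_zero, zero_add,
    Ico_add_one_right_eq_Icc]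
  refine sum_congr rfl fun k hk ↦ ?_
  have hk1 : 1 ≤ k := (mem_Icc.1 hk).1
  have hpow : y ^ ((q : ℤ) * k - q) = x ^ (k - 1) := by
    rw [← hyx, ← pow_mul, ← zpow_natCast]
    congr 1
    push_cast [Nat.cast_sub hk1]
    ring
  rw [hpow, hyx]
end

section
/- Let f : ℝ → ℝ be smooth and suppose f satisfies a homogeneous Euler differential equation of order n on (0,∞): there are real constants a_0, …, a_n with a_n ≠ 0 such that ∑_{k=0}^n a_k·x^k·f^{(k)}(x) = 0 for every x > 0. Let q ∈ ℕ with q ≥ 1 and define h : ℝ → ℝ by h(x) = f(x^{1/q}). Then h satisfies a homogeneous Euler differential equation of the same order n on (0,∞): there exist real constants b_0, …, b_n with b_n ≠ 0 such that ∑_{k=0}^n b_k·x^k·h^{(k)}(x) = 0 for every x > 0. -/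
open Real Finset

theorem hasDerivAt_iteratedDeriv_of_contDiffAt {f : ℝ → ℝ} {x : ℝ}
    (hf : ContDiffAt ℝ (⊤ : ℕ∞) f x) (k : ℕ) :
    HasDerivAt (iteratedDeriv k f) (iteratedDeriv (k + 1) f x) x := by
  rw [iteratedDeriv_succ]
  refine DifferentiableAt.hasDerivAt ?_
  rw [iteratedDeriv_eq_equiv_comp, LinearIsometryEquiv.comp_differentiableAt_iff]
  exact hf.differentiableAt_iteratedFDeriv (by exact_mod_cast WithTop.coe_lt_top k)

/-- Under a power substitution `f y = h (y ^ r)`, the Euler monomial `y ^ k * f⁽ᵏ⁾ y` is a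
combination with constant coefficients of the Euler monomials of `h` of order at most `k`, with
nonzero leading coefficient. -/
theorem exists_pow_mul_iteratedDeriv_eq_sum_of_rpow_comp {f h : ℝ → ℝ} {r : ℝ} (hr : r ≠ 0)
    (hf : ∀ x, 0 < x → ContDiffAt ℝ (⊤ : ℕ∞) f x)
    (hh : ∀ x, 0 < x → ContDiffAt ℝ (⊤ : ℕ∞) h x)
    (hfh : ∀ y, 0 < y → f y = h (y ^ r)) (k : ℕ) :
    ∃ c : ℕ → ℝ, c k ≠ 0 ∧ (∀ j, k < j → c j = 0) ∧ ∀ y, 0 < y →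
      y ^ k * iteratedDeriv k f y =
        ∑ j ∈ range (k + 1), c j * ((y ^ r) ^ j * iteratedDeriv j h (y ^ r)) := by
  induction k with
  | zero =>
    refine ⟨fun j => if j = 0 then 1 else 0, by simp, fun j hj => by simp [hj.ne'], ?_⟩
    intro y hy
    simp [hfh y hy]
  | succ k ih =>
    obtain ⟨c, hck, hc0, hc⟩ := ih
    refine ⟨fun j => (r * j - k) * c j + r * (if j = 0 then 0 else c (j - 1)), ?_, ?_, ?_⟩
    · simp [hc0, hr, hck]
    · rintro (_ | j) hj
      · omega
      · simp [hc0 (j + 1) (by omega), hc0 j (by omega)]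
    · intro y hy
      have hyr : 0 < y ^ r := rpow_pos_of_pos hy r
      have hL := (hasDerivAt_pow k y).mul (hasDerivAt_iteratedDeriv_of_contDiffAt (hf y hy) k)
      have hp : HasDerivAt (fun y : ℝ => y ^ r) (r * y ^ (r - 1)) y :=
        hasDerivAt_rpow_const (Or.inl hy.ne')
      have hR := HasDerivAt.fun_sum (u := range (k + 1)) fun j _ =>
        ((((hasDerivAt_pow j (y ^ r)).mul
          (hasDerivAt_iteratedDeriv_of_contDiffAt (hh _ hyr) j)).comp y hp).const_mul (c j))
      have hE := hL.unique (hR.congr_of_eventuallyEq (by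
        filter_upwards [lt_mem_nhds hy] with z hz using hc z hz))
      have hpow : ∀ (m : ℕ) (z : ℝ), z * ((m : ℝ) * z ^ (m - 1)) = m * z ^ m := by
        rintro (_ | m) z
        · simp
        · simp only [Nat.add_sub_cancel]; ring
      have hyy : y * y ^ (r - 1) = y ^ r := by
        rw [rpow_sub_one hy.ne']; field_simp
      have hE' := congrArg (fun t => y * t) hE
      simp only [mul_sum] at hE'
      have hterm : ∀ j ∈ range (k + 1),
          y * (c j * (((j : ℝ) * (y ^ r) ^ (j - 1) * iteratedDeriv j h (y ^ r)
            + (y ^ r) ^ j * iteratedDeriv (j + 1) h (y ^ r)) * (r * y ^ (r - 1)))) =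
          r * j * (c j * ((y ^ r) ^ j * iteratedDeriv j h (y ^ r)))
            + r * c j * ((y ^ r) ^ (j + 1) * iteratedDeriv (j + 1) h (y ^ r)) := by
        intro j _
        have e := hpow j (y ^ r)
        linear_combination (c j * r * ((j : ℝ) * (y ^ r) ^ (j - 1) * iteratedDeriv j h (y ^ r)
            + (y ^ r) ^ j * iteratedDeriv (j + 1) h (y ^ r))) * hyy
            + r * c j * iteratedDeriv j h (y ^ r) * e
      rw [sum_congr rfl hterm, sum_add_distrib] at hE'
      simp only [add_mul, sum_add_distrib]
      rw [sum_range_succ, sum_range_succ' (fun j => r * (if j = 0 then 0 else c (j - 1)) * _)]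
      simp only [hc0 (k + 1) (by omega), if_true, Nat.succ_ne_zero, if_false,
        Nat.add_sub_cancel, sub_mul, sum_sub_distrib]
      have hck' := hc y hy
      have e := hpow k y
      simp only [mul_assoc, ← mul_sum] at hE' hck' e ⊢
      linear_combination hE' - iteratedDeriv k f y * e - k * hck'

theorem euler_equation_of_rpow_comp (f : ℝ → ℝ) (hf : ContDiff ℝ (⊤ : ℕ∞) f) (n : ℕ)
    (a : ℕ → ℝ) (han : a n ≠ 0)
    (hDE : ∀ x : ℝ, 0 < x →
      ∑ k ∈ Finset.range (n + 1), a k * x ^ k * iteratedDeriv k f x = 0)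
    (q : ℕ) (hq : 1 ≤ q)
    (h : ℝ → ℝ) (hh : ∀ x : ℝ, h x = f (x ^ (1 / (q : ℝ)))) :
    ∃ b : ℕ → ℝ, b n ≠ 0 ∧
      ∀ x : ℝ, 0 < x →
        ∑ k ∈ Finset.range (n + 1), b k * x ^ k * iteratedDeriv k h x = 0 := by
  have hq0 : (q : ℝ) ≠ 0 := by positivity
  have hsmooth : ∀ x, 0 < x → ContDiffAt ℝ (⊤ : ℕ∞) h x := fun x hx => by
    rw [funext hh]
    exact hf.contDiffAt.comp x (contDiffAt_rpow_const_of_ne hx.ne')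
  have hfh : ∀ y : ℝ, 0 < y → f y = h (y ^ (q : ℝ)) := fun y hy => by
    rw [hh, ← rpow_mul hy.le, mul_one_div_cancel hq0, rpow_one]
  choose c hck hc0 hc using exists_pow_mul_iteratedDeriv_eq_sum_of_rpow_comp hq0
    (fun x _ => hf.contDiffAt) hsmooth hfh
  refine ⟨fun j => ∑ k ∈ range (n + 1), a k * c k j, ?_, fun x hx => ?_⟩
  · beta_reduce
    rw [sum_eq_single_of_mem n (self_mem_range_succ n)]
    · exact mul_ne_zero han (hck n)
    · intro k hk hkn
      rw [hc0 k n (by have := mem_range.mp hk; omega), mul_zero]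
  · have hy : 0 < x ^ (1 / (q : ℝ)) := rpow_pos_of_pos hx _
    have hyx : (x ^ (1 / (q : ℝ))) ^ (q : ℝ) = x := by
      rw [← rpow_mul hx.le, one_div_mul_cancel hq0, rpow_one]
    rw [← hDE _ hy]
    simp only [sum_mul]
    rw [sum_comm]
    refine sum_congr rfl fun k hk => ?_
    rw [mul_assoc, hc k _ hy, hyx, mul_sum]
    symm
    refine (sum_congr rfl fun j _ => by ring).trans
      (sum_subset (range_subset_range.mpr (by have := mem_range.mp hk; omega)) fun j _ hj => ?_)
    rw [hc0 k j (by have := mem_range.not.mp hj; omega)]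
    ring
end

section
/- Let P be a real polynomial of degree n and let q ∈ ℕ with q ≥ 1. Then the function h : ℝ → ℝ defined by h(x) = P(x^{1/q}) satisfies a homogeneous Euler differential equation of order ≤ n+1 on (0,∞): there exist real constants b_0, …, b_{n+1}, not all zero, such that ∑_{k=0}^{n+1} b_k·x^k·h^{(k)}(x) = 0 for every x > 0. -/
open Real Finset

/-- More real polynomials than points: some nontrivial linear combination of the family
vanishes at all the points. -/
theorem exists_nontrivial_sum_eval_eq_zero (p : ℕ → Polynomial ℝ) (r : ℕ → ℝ) (n : ℕ) :
    ∃ b : ℕ → ℝ, (∃ k ≤ n + 1, b k ≠ 0) ∧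
      ∀ j ∈ Finset.range (n + 1), ∑ k ∈ Finset.range (n + 2), b k * (p k).eval (r j) = 0 := by
  have hdep : ¬ LinearIndependent ℝ
      (fun (k : Fin (n + 2)) (j : Fin (n + 1)) => (p k).eval (r j)) := fun hli => by
    simpa using hli.fintype_card_le_finrank
  obtain ⟨g, hg, i, hi⟩ := Fintype.not_linearIndependent_iff.mp hdep
  refine ⟨fun k => if hk : k < n + 2 then g ⟨k, hk⟩ else 0, ⟨i, by omega, by simpa using hi⟩, ?_⟩
  intro j hj
  have hgj := congrFun hg ⟨j, Finset.mem_range.mp hj⟩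
  simp only [Finset.sum_apply, Pi.smul_apply, smul_eq_mul, Pi.zero_apply] at hgj
  rw [Finset.sum_range, ← hgj]
  simp

/-- On the positive axis `x ^ r` is an eigenfunction of `x ^ k * (d/dx) ^ k`. -/
theorem pow_mul_iteratedDeriv_rpow (r : ℝ) (k : ℕ) {x : ℝ} (hx : 0 < x) :
    x ^ k * iteratedDeriv k (fun y : ℝ => y ^ r) x = (descPochhammer ℝ k).eval r * x ^ r := by
  rw [iteratedDeriv_eq_iterate, Real.iter_deriv_rpow_const, Real.rpow_sub_natCast hx.ne']
  field_simp

theorem polynomial_rpow_comp_euler (P : Polynomial ℝ) (n : ℕ) (hP : P.natDegree = n)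
    (q : ℕ) (hq : 1 ≤ q)
    (h : ℝ → ℝ) (hh : ∀ x : ℝ, h x = P.eval (x ^ (1 / (q : ℝ)))) :
    ∃ b : ℕ → ℝ, (∃ k ≤ n + 1, b k ≠ 0) ∧
      ∀ x : ℝ, 0 < x →
        ∑ k ∈ Finset.range (n + 2), b k * x ^ k * iteratedDeriv k h x = 0 := by
  obtain ⟨b, hb, hsum⟩ :=
    exists_nontrivial_sum_eval_eq_zero (descPochhammer ℝ) (fun j => (j : ℝ) / q) n
  refine ⟨b, hb, fun x hx => ?_⟩
  have hloc : h =ᶠ[nhds x]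
      fun y => ∑ j ∈ Finset.range (n + 1), P.coeff j * y ^ ((j : ℝ) / q) := by
    filter_upwards [lt_mem_nhds hx] with y hy
    rw [hh, Polynomial.eval_eq_sum_range, hP]
    refine Finset.sum_congr rfl fun j _ => ?_
    rw [← Real.rpow_mul_natCast hy.le, one_div_mul_eq_div]
  have hderiv (k : ℕ) : x ^ k * iteratedDeriv k h x = ∑ j ∈ Finset.range (n + 1),
      P.coeff j * ((descPochhammer ℝ k).eval ((j : ℝ) / q) * x ^ ((j : ℝ) / q)) := by
    have hsmooth (j : ℕ) : ContDiffAt ℝ k (fun y : ℝ => y ^ ((j : ℝ) / q)) x :=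
      Real.contDiffAt_rpow_const_of_ne hx.ne'
    rw [hloc.iteratedDeriv_eq k,
      iteratedDeriv_fun_sum fun j _ => contDiffAt_const.mul (hsmooth j), Finset.mul_sum]
    refine Finset.sum_congr rfl fun j _ => ?_
    rw [iteratedDeriv_const_mul_field, mul_left_comm, pow_mul_iteratedDeriv_rpow _ _ hx]
  simp_rw [mul_assoc, hderiv, Finset.mul_sum]
  rw [Finset.sum_comm]
  refine Finset.sum_eq_zero fun j hj => ?_
  rw [← mul_zero (P.coeff j * x ^ ((j : ℝ) / q)), ← hsum j hj, Finset.mul_sum]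
  exact Finset.sum_congr rfl fun k _ => by ring
end

section
/- Let f : ℝ → ℝ be smooth, suppose f satisfies a simple differential equation of order ≤ n on (0,∞) with n ≥ 1, and let q ∈ ℕ with q ≥ 2. Then the ℝ[x]-linear span of the functions x ↦ x^{r/q}·f^{(k)}(x^{1/q}) (r, k ∈ ℕ) has dimension at most n·q; concretely, for every choice of n·q + 1 pairs (r_0,k_0), …, (r_{nq},k_{nq}) ∈ ℕ × ℕ there exist real polynomials c_0, …, c_{nq}, not all zero, such that ∑_{i=0}^{nq} c_i(x)·x^{r_i/q}·f^{(k_i)}(x^{1/q}) = 0 for every x > 0. -/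
open Real Finset

/-- `f` satisfies a simple differential equation of order ≤ `n` on `S`. -/
def SimpleDE (f : ℝ → ℝ) (n : ℕ) (S : Set ℝ) : Prop :=
  ∃ p : ℕ → Polynomial ℝ, (∃ k ≤ n, p k ≠ 0) ∧
    ∀ x ∈ S, ∑ k ∈ Finset.range (n + 1), (p k).eval x * iteratedDeriv k f x = 0

open Polynomial in
/-- On `(0, ∞)` some nonzero polynomial multiple of `g` is a polynomial combination of
the derivatives of `f` of order less than `m`. -/
def RationalCombination (f : ℝ → ℝ) (m : ℕ) (g : ℝ → ℝ) : Prop :=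
  ∃ d : ℝ[X], d ≠ 0 ∧ ∃ a : ℕ → ℝ[X],
    ∀ x > 0, d.eval x * g x = ∑ j ∈ range m, (a j).eval x * iteratedDeriv j f x

namespace RationalCombination

open Polynomial

variable {f g h : ℝ → ℝ} {m : ℕ}

theorem zero : RationalCombination f m (fun _ => 0) :=
  ⟨1, one_ne_zero, 0, by simp⟩

theorem add (hg : RationalCombination f m g) (hh : RationalCombination f m h) :
    RationalCombination f m (fun x => g x + h x) := by
  obtain ⟨d, hd, a, ha⟩ := hg
  obtain ⟨e, he, b, hb⟩ := hh
  refine ⟨d * e, mul_ne_zero hd he, fun j => e * a j + d * b j, fun x hx => ?_⟩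
  have hsum : ∑ j ∈ range m, (e * a j + d * b j).eval x * iteratedDeriv j f x =
      e.eval x * ∑ j ∈ range m, (a j).eval x * iteratedDeriv j f x +
        d.eval x * ∑ j ∈ range m, (b j).eval x * iteratedDeriv j f x := by
    rw [mul_sum, mul_sum, ← sum_add_distrib]
    refine sum_congr rfl fun j _ => ?_
    simp only [eval_add, eval_mul]
    ring
  rw [hsum, ← ha x hx, ← hb x hx, eval_mul]
  ring

theorem polynomial_mul (p : ℝ[X]) (hg : RationalCombination f m g) :
    RationalCombination f m (fun x => p.eval x * g x) := by
  obtain ⟨d, hd, a, ha⟩ := hg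
  refine ⟨d, hd, fun j => p * a j, fun x hx => ?_⟩
  rw [mul_left_comm, ha x hx, mul_sum]
  simp only [eval_mul, mul_assoc]

theorem sum {ι : Type*} (s : Finset ι) {g : ι → ℝ → ℝ}
    (hg : ∀ i ∈ s, RationalCombination f m (g i)) :
    RationalCombination f m (fun x => ∑ i ∈ s, g i x) := by
  classical
  induction s using Finset.induction_on with
  | empty => simpa using zero
  | insert i s hi ih =>
    simp only [sum_insert hi]
    exact (hg i (mem_insert_self i s)).add (ih fun j hj => hg j (mem_insert_of_mem hj))

theorem of_polynomial_mul_eq {p : ℝ[X]} (hp : p ≠ 0) (hh : RationalCombination f m h)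
    (hgh : ∀ x > 0, p.eval x * g x = h x) : RationalCombination f m g := by
  obtain ⟨d, hd, a, ha⟩ := hh
  refine ⟨d * p, mul_ne_zero hd hp, a, fun x hx => ?_⟩
  rw [eval_mul, mul_assoc, hgh x hx, ha x hx]

theorem iteratedDeriv_of_lt {k : ℕ} (hk : k < m) :
    RationalCombination f m (iteratedDeriv k f) := by
  refine ⟨1, one_ne_zero, fun j => if j = k then 1 else 0, fun x _ => ?_⟩
  rw [sum_eq_single_of_mem k (mem_range.2 hk) (by intro j _ hj; simp [hj])]
  simp

/-- If `f^{(m)}` is a rational combination of the lower derivatives, so is every derivative. -/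
theorem iteratedDeriv (hf : ContDiff ℝ (⊤ : ℕ∞) f)
    (hm : RationalCombination f m (iteratedDeriv m f)) (k : ℕ) :
    RationalCombination f m (_root_.iteratedDeriv k f) := by
  have hle : ∀ j ≤ m, RationalCombination f m (_root_.iteratedDeriv j f) := fun j hj =>
    hj.lt_or_eq.elim iteratedDeriv_of_lt (fun h => h ▸ hm)
  have hderiv : ∀ j x, HasDerivAt (_root_.iteratedDeriv j f)
      (_root_.iteratedDeriv (j + 1) f x) x := by
    intro j x
    rw [iteratedDeriv_succ]
    exact ((hf.differentiable_iteratedDeriv j (by exact_mod_cast ENat.natCast_lt_top j)) x).hasDerivAt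
  induction k with
  | zero => exact hle 0 m.zero_le
  | succ k ih =>
    obtain ⟨d, hd, a, ha⟩ := id ih
    have hrhs : RationalCombination f m (fun x =>
        (∑ j ∈ range m, ((derivative (a j)).eval x * _root_.iteratedDeriv j f x +
          (a j).eval x * _root_.iteratedDeriv (j + 1) f x)) +
        (-derivative d).eval x * _root_.iteratedDeriv k f x) := by
      refine add (sum _ fun j hj => ?_) (polynomial_mul _ ih)
      have hj := mem_range.1 hj
      exact add (polynomial_mul _ (hle j hj.le)) (polynomial_mul _ (hle (j + 1) hj))
    refine of_polynomial_mul_eq hd hrhs fun x hx => ?_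
    have hl := (d.hasDerivAt x).mul (hderiv k x)
    have hr : HasDerivAt (fun x => ∑ j ∈ range m, (a j).eval x * _root_.iteratedDeriv j f x)
        (∑ j ∈ range m, ((derivative (a j)).eval x * _root_.iteratedDeriv j f x +
          (a j).eval x * _root_.iteratedDeriv (j + 1) f x)) x :=
      HasDerivAt.fun_sum fun j _ => ((a j).hasDerivAt x).mul (hderiv j x)
    have heq := hl.unique (hr.congr_of_eventuallyEq
      (Filter.eventually_of_mem (Ioi_mem_nhds hx) fun y hy => ha y hy))
    rw [← heq, eval_neg]
    ring

end RationalCombination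

/-- The order of a simple differential equation may be lowered until its leading coefficient is
nonzero. -/
theorem SimpleDE.exists_rationalCombination {f : ℝ → ℝ} {n : ℕ}
    (h : SimpleDE f n (Set.Ioi 0)) :
    ∃ m ≤ n, RationalCombination f m (iteratedDeriv m f) := by
  classical
  obtain ⟨p, ⟨k, hk, hpk⟩, hp⟩ := h
  set m := Nat.findGreatest (fun k => p k ≠ 0) n with hm
  have hmn : m ≤ n := Nat.findGreatest_le n
  have hpm : p m ≠ 0 := Nat.findGreatest_spec (P := fun k => p k ≠ 0) hk hpk
  refine ⟨m, hmn, p m, hpm, fun j => -p j, fun x hx => ?_⟩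
  have hsub : ∑ k ∈ range (m + 1), (p k).eval x * iteratedDeriv k f x = 0 := by
    rw [← hp x hx]
    refine sum_subset (range_subset_range.2 (by lia)) fun j hj hj' => ?_
    have hj0 : p j = 0 := by
      simpa using Nat.findGreatest_is_greatest (P := fun k => p k ≠ 0) (n := n) (k := j)
        (by rw [mem_range] at hj'; lia) (by rw [mem_range] at hj; lia)
    simp [hj0]
  rw [sum_range_succ] at hsub
  simp only [Polynomial.eval_neg, neg_mul, sum_neg_distrib]
  linarith

open Polynomial in
/-- Since `ℝ[X]` has rank `q` over `ℝ[X ^ q]`, any `m * q + 1` vectors of `ℝ[X] ^ m` are linearly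
dependent over `ℝ[X ^ q]`. -/
theorem exists_sum_expand_mul_eq_zero {ι : Type*} [Fintype ι] {m q : ℕ} (hq : 0 < q)
    (hι : m * q < Fintype.card ι) (A : ι → Fin m → ℝ[X]) :
    ∃ c : ι → ℝ[X], (∃ i, c i ≠ 0) ∧ ∀ j, ∑ i, expand ℝ q (c i) * A i j = 0 := by
  classical
  set B : ℕ := ∑ i, ∑ j, (A i j).natDegree with hB
  have hAB : ∀ i j, (A i j).natDegree ≤ B := fun i j =>
    (single_le_sum (f := fun j => (A i j).natDegree) (fun _ _ => Nat.zero_le _)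
      (mem_univ j)).trans (single_le_sum (f := fun i => ∑ j, (A i j).natDegree)
        (fun _ _ => Nat.zero_le _) (mem_univ i))
  set N : ℕ := m * B + 1 with hN
  set L : ℕ := q * N + B with hL
  let φ : (ι → degreeLT ℝ N) →ₗ[ℝ] (Fin m → Fin L → ℝ) :=
    LinearMap.pi fun j => LinearMap.pi fun t =>
      ∑ i, (lcoeff ℝ t) ∘ₗ (LinearMap.mulRight ℝ (A i j)) ∘ₗ (expand ℝ q).toLinearMap ∘ₗ
        (degreeLT ℝ N).subtype ∘ₗ LinearMap.proj i
  have hφ : ∀ c j t, φ c j t = (∑ i, expand ℝ q (c i : ℝ[X]) * A i j).coeff t := by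
    intro c j t
    simp [φ, finsetSum_coeff]
  have : FiniteDimensional ℝ (degreeLT ℝ N) := (degreeLTEquiv ℝ N).symm.finiteDimensional
  have hrank : Module.finrank ℝ (Fin m → Fin L → ℝ) < Module.finrank ℝ (ι → degreeLT ℝ N) := by
    simp only [Module.finrank_pi_fintype, Module.finrank_self, mul_one, (degreeLTEquiv ℝ N).finrank_eq, sum_const, card_univ,
      Fintype.card_fin, smul_eq_mul]
    calc m * L = (m * q) * N + m * B := by rw [hL]; ring
      _ < (m * q + 1) * N := by rw [add_mul, one_mul]; lia
      _ ≤ Fintype.card ι * N := Nat.mul_le_mul_right N hι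
  obtain ⟨c, hc, hc0⟩ := Submodule.exists_mem_ne_zero_of_ne_bot
    (LinearMap.ker_ne_bot_of_finrank_lt (f := φ) hrank)
  refine ⟨fun i => c i, ?_, fun j => ?_⟩
  · obtain ⟨i, hi⟩ := Function.ne_iff.1 hc0
    exact ⟨i, fun h => hi (Subtype.ext h)⟩
  · ext t
    by_cases ht : t < L
    · have := hφ c j ⟨t, ht⟩
      rw [LinearMap.mem_ker.1 hc] at this
      simpa using this.symm
    · rw [finsetSum_coeff, coeff_zero]
      refine sum_eq_zero fun i _ => coeff_eq_zero_of_natDegree_lt ?_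
      have hci : (c i : ℝ[X]).natDegree < N := by
        by_cases h0 : (c i : ℝ[X]) = 0
        · rw [h0, natDegree_zero]; lia
        · exact (natDegree_lt_iff_degree_lt h0).2 (mem_degreeLT.1 (c i).2)
      calc (expand ℝ q (c i : ℝ[X]) * A i j).natDegree
          ≤ (c i : ℝ[X]).natDegree * q + (A i j).natDegree := by
            simpa [natDegree_expand] using
              natDegree_mul_le (p := expand ℝ q (c i : ℝ[X])) (q := A i j)
        _ < q * N + B := add_lt_add_of_lt_of_le
            (by rw [mul_comm]; exact Nat.mul_lt_mul_of_pos_left hci hq) (hAB i j)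
        _ ≤ t := not_lt.1 ht

/-- A nonzero polynomial factor of a vanishing product cancels against a continuous function. -/
theorem eq_zero_of_polynomial_mul_eq_zero {D : Polynomial ℝ} (hD : D ≠ 0) {h : ℝ → ℝ}
    (hh : Continuous h) {s : Set ℝ} (hs : IsOpen s) (hDh : ∀ y ∈ s, D.eval y * h y = 0)
    {y : ℝ} (hy : y ∈ s) : h y = 0 := by
  by_contra hne
  have hU : IsOpen (s ∩ {z | h z ≠ 0}) := hs.inter (isOpen_ne_fun hh continuous_const)
  have hinf : (s ∩ {z | h z ≠ 0}).Infinite := infinite_of_mem_nhds y (hU.mem_nhds ⟨hy, hne⟩)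
  exact hD (Polynomial.eq_zero_of_infinite_isRoot D
    (hinf.mono fun z hz => (mul_eq_zero.1 (hDh z hz.1)).resolve_right hz.2))

theorem span_dimension_le (f : ℝ → ℝ) (hf : ContDiff ℝ (⊤ : ℕ∞) f) (n : ℕ) (hn : 1 ≤ n)
    (hDE : SimpleDE f n (Set.Ioi 0)) (q : ℕ) (hq : 2 ≤ q) :
    ∀ rk : Fin (n * q + 1) → ℕ × ℕ,
      ∃ c : Fin (n * q + 1) → Polynomial ℝ, (∃ i, c i ≠ 0) ∧
        ∀ x : ℝ, 0 < x →
          ∑ i : Fin (n * q + 1),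
            (c i).eval x * x ^ (((rk i).1 : ℝ) / q) *
              iteratedDeriv (rk i).2 f (x ^ (1 / (q : ℝ))) = 0 := by
  classical
  intro rk
  have hq0 : 0 < q := by lia
  obtain ⟨m, hmn, hm⟩ := hDE.exists_rationalCombination
  choose d hd a ha using fun k => RationalCombination.iteratedDeriv hf hm k
  -- clear denominators: `D * y ^ r * f^{(k)} = ∑ j, A j * f^{(j)}` for each of the given pairs
  let D : Polynomial ℝ := ∏ i, d (rk i).2
  have hD : D ≠ 0 := prod_ne_zero_iff.2 fun i _ => hd _
  let A : Fin (n * q + 1) → Fin m → Polynomial ℝ := fun i j =>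
    (∏ l ∈ univ.erase i, d (rk l).2) * Polynomial.X ^ (rk i).1 * a (rk i).2 j
  have hA : ∀ i, ∀ y > 0, D.eval y * (y ^ (rk i).1 * iteratedDeriv (rk i).2 f y) =
      ∑ j, (A i j).eval y * iteratedDeriv j f y := by
    intro i y hy
    have hDi : D = d (rk i).2 * ∏ l ∈ univ.erase i, d (rk l).2 :=
      (mul_prod_erase univ (fun l => d (rk l).2) (mem_univ i)).symm
    have hdi := ha (rk i).2 y hy
    rw [← Fin.sum_univ_eq_sum_range (fun j => (a (rk i).2 j).eval y * iteratedDeriv j f y)] at hdi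
    calc D.eval y * (y ^ (rk i).1 * iteratedDeriv (rk i).2 f y)
        = ((∏ l ∈ univ.erase i, d (rk l).2).eval y * y ^ (rk i).1) *
            ((d (rk i).2).eval y * iteratedDeriv (rk i).2 f y) := by
          rw [hDi, Polynomial.eval_mul]; ring
      _ = ∑ j, (A i j).eval y * iteratedDeriv j f y := by
          rw [hdi, mul_sum]
          refine sum_congr rfl fun j _ => ?_
          simp only [A, Polynomial.eval_mul, Polynomial.eval_pow, Polynomial.eval_X]
          ring
  obtain ⟨c, hc, hcA⟩ := exists_sum_expand_mul_eq_zero hq0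
    (by rw [Fintype.card_fin]; exact Nat.lt_succ_of_le (Nat.mul_le_mul_right q hmn)) A
  refine ⟨c, hc, fun x hx => ?_⟩
  let h : ℝ → ℝ := fun y => ∑ i, (c i).eval (y ^ q) *
    (y ^ (rk i).1 * iteratedDeriv (rk i).2 f y)
  have hcont : Continuous h := by
    refine continuous_finsetSum _ fun i _ => ((c i).continuous.comp (continuous_pow q)).mul
      ((continuous_pow _).mul (hf.continuous_iteratedDeriv _ ?_))
    exact_mod_cast le_top
  have hDh : ∀ y ∈ Set.Ioi (0 : ℝ), D.eval y * h y = 0 := by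
    intro y hy
    calc D.eval y * h y
        = ∑ i, (c i).eval (y ^ q) * ∑ j, (A i j).eval y * iteratedDeriv j f y := by
          simp only [h, mul_sum (s := (univ : Finset (Fin (n * q + 1)))), mul_left_comm (D.eval y)]
          refine sum_congr rfl fun i _ => ?_
          rw [← hA i y hy]; ring
      _ = ∑ j : Fin m, (∑ i, Polynomial.expand ℝ q (c i) * A i j).eval y *
            iteratedDeriv j f y := by
          simp only [mul_sum, Polynomial.eval_finsetSum, sum_mul, Polynomial.eval_mul,
            Polynomial.expand_eval, mul_assoc]
          exact sum_comm
      _ = 0 := by simp [hcA]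
  have hroot := eq_zero_of_polynomial_mul_eq_zero hD hcont isOpen_Ioi hDh
    (Real.rpow_pos_of_pos hx (1 / (q : ℝ)))
  rw [← hroot]
  refine sum_congr rfl fun i _ => ?_
  have hpow : (x ^ (1 / (q : ℝ))) ^ q = x := by
    rw [one_div, Real.rpow_inv_natCast_pow hx.le hq0.ne']
  have hr : (x ^ (1 / (q : ℝ))) ^ (rk i).1 = x ^ (((rk i).1 : ℝ) / q) := by
    rw [← Real.rpow_natCast, ← Real.rpow_mul hx.le, one_div_mul_eq_div]
  rw [hpow, hr, mul_assoc]
end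

section
/- Let f : ℝ → ℝ be smooth and suppose f satisfies a simple differential equation of order ≤ n on ℝ with n ≥ 1. Then its derivative f' = deriv f satisfies a simple differential equation of order ≤ n on ℝ. -/
open Real Finset

open Polynomial in
/-- Eliminating the zeroth-order term between a linear differential relation and its derivative
yields a relation for the derivative. -/
theorem sum_eliminate_zeroth_order {f : ℝ → ℝ} (hf : ContDiff ℝ (⊤ : ℕ∞) f) {n : ℕ}
    {p : ℕ → ℝ[X]} (hp : p (n + 1) = 0)
    (h : ∀ x, ∑ k ∈ range (n + 1), (p k).eval x * iteratedDeriv k f x = 0) (x : ℝ) :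
    ∑ k ∈ range (n + 1),
      (p 0 * derivative (p (k + 1)) + p 0 * p k - derivative (p 0) * p (k + 1)).eval x *
        iteratedDeriv (k + 1) f x = 0 := by
  have hderiv (k : ℕ) : HasDerivAt (iteratedDeriv k f) (iteratedDeriv (k + 1) f x) x := by
    rw [iteratedDeriv_succ]
    exact ((hf.differentiable_iteratedDeriv k (by exact_mod_cast ENat.natCast_lt_top k)) x).hasDerivAt
  have hsum : HasDerivAt (fun y ↦ ∑ k ∈ range (n + 1), (p k).eval y * iteratedDeriv k f y)
      (∑ k ∈ range (n + 1), ((derivative (p k)).eval x * iteratedDeriv k f x +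
        (p k).eval x * iteratedDeriv (k + 1) f x)) x :=
    HasDerivAt.fun_sum fun k _ ↦ ((p k).hasDerivAt x).mul (hderiv k)
  have hzero : ∑ k ∈ range (n + 1), ((derivative (p k)).eval x * iteratedDeriv k f x +
      (p k).eval x * iteratedDeriv (k + 1) f x) = 0 := by
    simp only [h] at hsum
    exact hsum.unique (hasDerivAt_const x 0)
  rw [sum_add_distrib] at hzero
  have hshift := sum_range_succ' (fun k ↦ (p k).eval x * iteratedDeriv k f x) (n + 1)
  have hshift' := sum_range_succ' (fun k ↦ (derivative (p k)).eval x * iteratedDeriv k f x) (n + 1)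
  rw [sum_range_succ, h x] at hshift
  rw [sum_range_succ] at hshift'
  simp only [hp, derivative_zero, eval_zero, zero_mul, add_zero] at hshift hshift'
  have hexpand : ∑ k ∈ range (n + 1),
      (p 0 * derivative (p (k + 1)) + p 0 * p k - derivative (p 0) * p (k + 1)).eval x *
        iteratedDeriv (k + 1) f x =
      (p 0).eval x * ∑ k ∈ range (n + 1),
        (derivative (p (k + 1))).eval x * iteratedDeriv (k + 1) f x +
      (p 0).eval x * ∑ k ∈ range (n + 1), (p k).eval x * iteratedDeriv (k + 1) f x -
      (derivative (p 0)).eval x * ∑ k ∈ range (n + 1),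
        (p (k + 1)).eval x * iteratedDeriv (k + 1) f x := by
    simp only [mul_sum, ← sum_add_distrib, ← sum_sub_distrib]
    refine sum_congr rfl fun k _ ↦ ?_
    simp only [eval_add, eval_sub, eval_mul]
    ring
  rw [hexpand]
  linear_combination (p 0).eval x * hzero - (p 0).eval x * hshift' +
    (derivative (p 0)).eval x * hshift

theorem SimpleDE.exists_eq_zero_of_lt {f : ℝ → ℝ} {n : ℕ} {S : Set ℝ} (h : SimpleDE f n S) :
    ∃ p : ℕ → Polynomial ℝ, (∃ k ≤ n, p k ≠ 0) ∧ (∀ k, n < k → p k = 0) ∧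
      ∀ x ∈ S, ∑ k ∈ range (n + 1), (p k).eval x * iteratedDeriv k f x = 0 := by
  obtain ⟨p, ⟨k, hk, hpk⟩, h⟩ := h
  refine ⟨fun k ↦ if k ≤ n then p k else 0, ⟨k, hk, by simpa [hk] using hpk⟩,
    fun k hk ↦ if_neg hk.not_ge, fun x hx ↦ ?_⟩
  rw [← h x hx]
  refine sum_congr rfl fun k hk ↦ ?_
  simp [Nat.lt_succ_iff.mp (mem_range.mp hk)]

theorem simpleDE_deriv (f : ℝ → ℝ) (hf : ContDiff ℝ (⊤ : ℕ∞) f) (n : ℕ) (hn : 1 ≤ n)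
    (hDE : SimpleDE f n Set.univ) :
    SimpleDE (deriv f) n Set.univ := by
  classical
  obtain ⟨p, ⟨k, hk, hpk⟩, hp, h⟩ := hDE.exists_eq_zero_of_lt
  replace h x := h x (Set.mem_univ x)
  by_cases hp0 : p 0 = 0
  · obtain ⟨j, rfl⟩ := Nat.exists_eq_succ_of_ne_zero (fun hk0 : k = 0 ↦ hpk (hk0 ▸ hp0))
    refine ⟨fun k ↦ p (k + 1), ⟨j, by lia, hpk⟩, fun x _ ↦ ?_⟩
    have hshift := sum_range_succ' (fun k ↦ (p k).eval x * iteratedDeriv k f x) (n + 1)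
    rw [sum_range_succ, h x] at hshift
    simpa [hp, hp0, iteratedDeriv_succ'] using hshift.symm
  · refine ⟨fun k ↦ p 0 * (p (k + 1)).derivative + p 0 * p k - (p 0).derivative * p (k + 1),
      ⟨Nat.findGreatest (p · ≠ 0) n, Nat.findGreatest_le n, ?_⟩, fun x _ ↦ ?_⟩
    · have hne : p (Nat.findGreatest (p · ≠ 0) n) ≠ 0 :=
        Nat.findGreatest_spec (P := (p · ≠ 0)) hk hpk
      have hnext : p (Nat.findGreatest (p · ≠ 0) n + 1) = 0 := by
        by_cases hle : Nat.findGreatest (p · ≠ 0) n + 1 ≤ n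
        · exact not_not.mp (Nat.findGreatest_is_greatest (Nat.lt_succ_self _) hle)
        · exact hp _ (not_le.mp hle)
      simpa [hnext] using ⟨hp0, hne⟩
    · simpa only [iteratedDeriv_succ'] using
        sum_eliminate_zeroth_order hf (hp _ n.lt_succ_self) h x
end

section
/- Let f, g : ℝ → ℝ be smooth, suppose f satisfies a simple differential equation of order ≤ n on ℝ and g satisfies a simple differential equation of order ≤ m on ℝ, with n ≥ 1 and m ≥ 1. Then the sum f + g satisfies a simple differential equation of order ≤ n + m on ℝ. -/
open Real Finset

open Polynomial in
/-- Any family of more than `N` polynomials of degree less than `N` is linearly dependent. -/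
theorem exists_sum_smul_eq_zero_of_degree_lt {R ι : Type*} [CommRing R] [Nontrivial R] [Fintype ι]
    {N : ℕ} (w : ι → R[X]) (hw : ∀ i, (w i).degree < N) (hN : N < Fintype.card ι) :
    ∃ c : ι → R, ∑ i, c i • w i = 0 ∧ ∃ i, c i ≠ 0 := by
  have hdep : ¬ LinearIndependent R (fun i (k : Fin N) => (w i).coeff k) := fun h => by
    have := h.fintype_card_le_finrank
    rw [Module.finrank_fin_fun] at this
    omega
  obtain ⟨c, hc, hc0⟩ := Fintype.not_linearIndependent_iff.1 hdep
  refine ⟨c, ?_, hc0⟩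
  ext k
  rw [finsetSum_coeff, coeff_zero]
  by_cases hk : k < N
  · simpa using congrFun hc ⟨k, hk⟩
  · refine Finset.sum_eq_zero fun i _ => ?_
    rw [coeff_smul, coeff_eq_zero_of_degree_lt, smul_zero]
    exact (hw i).trans_le (by exact_mod_cast not_lt.1 hk)

namespace PolyDiffOp

open Polynomial

/-- The value at `x` of `∑ k, p k * f^(k)`, where the polynomial `∑ k, p k * Y ^ k` encodes the
differential operator with coefficients `p k`. -/
noncomputable def apply (f : ℝ → ℝ) (x : ℝ) : ℝ[X][X] →ₗ[ℝ] ℝ :=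
  lsum fun k => iteratedDeriv k f x • leval x

/-- Left composition of a differential operator with differentiation. -/
noncomputable def diff : ℝ[X][X] →ₗ[ℝ] ℝ[X][X] :=
  lsum fun k => (monomial (k + 1)).restrictScalars ℝ + (monomial k).restrictScalars ℝ ∘ₗ derivative

theorem apply_monomial (f : ℝ → ℝ) (x : ℝ) (k : ℕ) (p : ℝ[X]) :
    apply f x (monomial k p) = p.eval x * iteratedDeriv k f x := by
  simp [apply, lsum, sum_monomial_index, mul_comm]

theorem apply_smul (f : ℝ → ℝ) (x : ℝ) (a : ℝ[X]) (P : ℝ[X][X]) :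
    apply f x (a • P) = a.eval x * apply f x P := by
  induction P using Polynomial.induction_on' with
  | add P Q hP hQ => rw [smul_add, map_add, map_add, hP, hQ, mul_add]
  | monomial k p => simp [smul_monomial, apply_monomial, mul_assoc]

theorem apply_eq_sum_range (f : ℝ → ℝ) (x : ℝ) {P : ℝ[X][X]} {N : ℕ} (hP : P.degree < N) :
    apply f x P = ∑ k ∈ Finset.range N, (P.coeff k).eval x * iteratedDeriv k f x := by
  have h : P = ∑ k ∈ Finset.range N, monomial k (P.coeff k) := by
    ext1 k
    simp only [finsetSum_coeff, coeff_monomial, Finset.sum_ite_eq', Finset.mem_range]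
    split_ifs with hk
    · rfl
    · exact coeff_eq_zero_of_degree_lt (hP.trans_le (by exact_mod_cast not_lt.1 hk))
  conv_lhs => rw [h]
  simp only [map_sum, apply_monomial]

theorem diff_monomial (k : ℕ) (p : ℝ[X]) :
    diff (monomial k p) = monomial (k + 1) p + monomial k (derivative p) := by
  simp [diff, lsum, sum_monomial_index]

theorem hasDerivAt_apply {f : ℝ → ℝ} (hf : ContDiff ℝ (⊤ : ℕ∞) f) (P : ℝ[X][X]) (x : ℝ) :
    HasDerivAt (fun y => apply f y P) (apply f x (diff P)) x := by
  induction P using Polynomial.induction_on' with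
  | add P Q hP hQ => simpa only [map_add] using hP.fun_add hQ
  | monomial k p =>
    simp only [diff_monomial, map_add, apply_monomial]
    have hd : HasDerivAt (iteratedDeriv k f) (iteratedDeriv (k + 1) f x) x := by
      rw [iteratedDeriv_succ]
      exact (hf.differentiable_iteratedDeriv k (by exact_mod_cast WithTop.coe_lt_top k) x).hasDerivAt
    rw [add_comm]
    exact (p.hasDerivAt x).mul hd

theorem apply_diff_iterate_eq_zero {f : ℝ → ℝ} (hf : ContDiff ℝ (⊤ : ℕ∞) f) {P : ℝ[X][X]}
    (hP : ∀ x, apply f x P = 0) (i : ℕ) (x : ℝ) : apply f x (diff^[i] P) = 0 := by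
  induction i generalizing x with
  | zero => exact hP x
  | succ i ih =>
    rw [Function.iterate_succ_apply']
    refine (hasDerivAt_apply hf _ x).unique ?_
    simpa only [ih] using hasDerivAt_const x (0 : ℝ)

theorem coeff_diff_succ (P : ℝ[X][X]) (k : ℕ) :
    (diff P).coeff (k + 1) = P.coeff k + derivative (P.coeff (k + 1)) := by
  induction P using Polynomial.induction_on' with
  | add P Q hP hQ => simp only [map_add, coeff_add, hP, hQ]; ring
  | monomial j p =>
    simp only [diff_monomial, coeff_add, coeff_monomial, add_left_inj]
    split_ifs <;> simp

theorem degree_diff (P : ℝ[X][X]) : (diff P).degree = P.degree + 1 := by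
  rcases eq_or_ne P 0 with rfl | hP
  · simp
  rw [degree_eq_natDegree hP, ← Nat.cast_add_one]
  refine le_antisymm ((degree_le_iff_coeff_zero _ _).2 fun k hk => ?_) (le_degree_of_ne_zero ?_)
  · obtain _ | k := k
    · exact absurd hk (by simp)
    · have hk : P.natDegree + 1 < k + 1 := by exact_mod_cast hk
      replace hk := Nat.lt_of_succ_lt_succ hk
      rw [coeff_diff_succ, coeff_eq_zero_of_natDegree_lt hk,
        coeff_eq_zero_of_natDegree_lt (hk.trans k.lt_succ_self), derivative_zero, add_zero]
  · rw [coeff_diff_succ, coeff_eq_zero_of_natDegree_lt P.natDegree.lt_succ_self, derivative_zero,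
      add_zero]
    exact leadingCoeff_ne_zero.2 hP

theorem degree_diff_iterate (P : ℝ[X][X]) (i : ℕ) : (diff^[i] P).degree = P.degree + i := by
  induction i with
  | zero => simp
  | succ i ih => rw [Function.iterate_succ_apply', degree_diff, ih, add_assoc, Nat.cast_succ]

theorem linearIndependent_diff_iterate {P : ℝ[X][X]} (hP : P ≠ 0) :
    LinearIndependent ℝ[X] fun i : ℕ => diff^[i] P := by
  rw [linearIndependent_iff']
  intro s c hc
  have hdeg (i : ℕ) (hi : c i ≠ 0) : (c i • diff^[i] P).degree = (P.natDegree + i : ℕ) := by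
    rw [smul_eq_C_mul, degree_C_mul hi, degree_diff_iterate, degree_eq_natDegree hP, Nat.cast_add]
  have hsum := degree_sum_eq_of_disjoint (fun i => c i • diff^[i] P) s ?_
  · rw [hc, degree_zero, eq_comm, Finset.sup_eq_bot_iff] at hsum
    intro i hi
    by_contra hci
    have := hsum i hi
    rw [hdeg i hci] at this
    exact WithBot.coe_ne_bot this
  · rintro i ⟨-, hi⟩ j ⟨-, hj⟩ hij h
    have h : (c i • diff^[i] P).degree = (c j • diff^[j] P).degree := h
    rw [hdeg i (left_ne_zero_of_smul hi), hdeg j (left_ne_zero_of_smul hj)] at h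
    have h : P.natDegree + i = P.natDegree + j := by exact_mod_cast h
    omega

end PolyDiffOp

open Polynomial PolyDiffOp in
/-- Two nonzero operators of orders `≤ n` and `≤ m` have a nonzero common left multiple of
order `≤ n + m`. -/
theorem PolyDiffOp.exists_common_multiple {P Q : ℝ[X][X]} (hP : P ≠ 0) (hQ : Q ≠ 0) {n m : ℕ}
    (hPn : P.degree ≤ n) (hQm : Q.degree ≤ m) :
    ∃ (a : Fin (m + 1) → ℝ[X]) (b : Fin (n + 1) → ℝ[X]),
      ∑ i, a i • diff^[i] P = ∑ j, b j • diff^[j] Q ∧ ∑ i, a i • diff^[i] P ≠ 0 ∧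
      (∑ i, a i • diff^[i] P).degree < (n + m + 1 : ℕ) := by
  have hPi (i : Fin (m + 1)) : (diff^[i] P).degree < (n + m + 1 : ℕ) := by
    rw [degree_diff_iterate]
    refine (add_le_add_left hPn _).trans_lt ?_
    exact_mod_cast (by omega : n + (i : ℕ) < n + m + 1)
  have hQj (j : Fin (n + 1)) : (diff^[j] Q).degree < (n + m + 1 : ℕ) := by
    rw [degree_diff_iterate]
    refine (add_le_add_left hQm _).trans_lt ?_
    exact_mod_cast (by omega : m + (j : ℕ) < n + m + 1)
  obtain ⟨c, hc, hc0⟩ := exists_sum_smul_eq_zero_of_degree_lt (N := n + m + 1)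
    (Sum.elim (fun i : Fin (m + 1) => diff^[i] P) (fun j : Fin (n + 1) => diff^[j] Q))
    (by rintro (i | j); exacts [hPi i, hQj j]) (by simp; omega)
  simp only [Fintype.sum_sum_type, Sum.elim_inl, Sum.elim_inr] at hc
  have heq : ∑ i, c (.inl i) • diff^[i] P = ∑ j, (-c (.inr j)) • diff^[j] Q := by
    simpa [neg_smul] using eq_neg_of_add_eq_zero_left hc
  refine ⟨fun i => c (.inl i), fun j => -c (.inr j), heq, fun h0 => ?_, ?_⟩
  · have hli {R : ℝ[X][X]} (hR : R ≠ 0) (k : ℕ) (d : Fin k → ℝ[X])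
        (hd : ∑ i, d i • diff^[i] R = 0) : ∀ i, d i = 0 :=
      Fintype.linearIndependent_iff.1
        ((linearIndependent_diff_iterate hR).comp _ Fin.val_injective) d hd
    obtain ⟨i | j, hi⟩ := hc0
    · exact hi (hli hP _ _ h0 i)
    · exact hi (neg_eq_zero.1 (hli hQ _ _ (heq.symm.trans h0) j))
  · rw [← mem_degreeLT]
    exact Submodule.sum_mem _ fun i _ => Submodule.smul_mem _ _ (mem_degreeLT.2 (hPi i))

open Polynomial PolyDiffOp in
/-- The operator of a simple differential equation. -/
theorem SimpleDE.exists_polyDiffOp {f : ℝ → ℝ} {n : ℕ} (h : SimpleDE f n Set.univ) :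
    ∃ P : ℝ[X][X], P ≠ 0 ∧ P.degree ≤ n ∧ ∀ x, apply f x P = 0 := by
  obtain ⟨p, ⟨k, hk, hpk⟩, hp⟩ := h
  refine ⟨∑ k ∈ Finset.range (n + 1), monomial k (p k), fun h0 => hpk ?_, ?_, fun x => ?_⟩
  · simpa [coeff_monomial, Nat.lt_succ_iff, hk] using congrArg (coeff · k) h0
  · refine (degree_sum_le _ _).trans (Finset.sup_le fun k hk => (degree_monomial_le _ _).trans ?_)
    exact_mod_cast Nat.lt_succ_iff.1 (Finset.mem_range.1 hk)
  · simpa [apply_monomial] using hp x trivial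

open Polynomial PolyDiffOp in
theorem simpleDE_add (f g : ℝ → ℝ) (hf : ContDiff ℝ (⊤ : ℕ∞) f) (hg : ContDiff ℝ (⊤ : ℕ∞) g)
    (n m : ℕ) (hn : 1 ≤ n) (hm : 1 ≤ m)
    (hfDE : SimpleDE f n Set.univ) (hgDE : SimpleDE g m Set.univ) :
    SimpleDE (f + g) (n + m) Set.univ := by
  obtain ⟨P, hP, hPn, hPf⟩ := hfDE.exists_polyDiffOp
  obtain ⟨Q, hQ, hQm, hQg⟩ := hgDE.exists_polyDiffOp
  obtain ⟨a, b, hab, h0, hdeg⟩ := exists_common_multiple hP hQ hPn hQm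
  have hLf (x : ℝ) : apply f x (∑ i, a i • diff^[i] P) = 0 := by
    simp [apply_smul, apply_diff_iterate_eq_zero hf hPf]
  have hLg (x : ℝ) : apply g x (∑ i, a i • diff^[i] P) = 0 := by
    simp [hab, apply_smul, apply_diff_iterate_eq_zero hg hQg]
  generalize ∑ i, a i • diff^[i] P = L at h0 hdeg hLf hLg
  refine ⟨L.coeff, ⟨L.natDegree, ?_, leadingCoeff_ne_zero.2 h0⟩, fun x _ => ?_⟩
  · exact Nat.lt_succ_iff.1 ((natDegree_lt_iff_degree_lt h0).2 hdeg)
  · rw [← add_zero (0 : ℝ)]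
    nth_rw 1 [← hLf x]
    rw [← hLg x, apply_eq_sum_range f x hdeg, apply_eq_sum_range g x hdeg,
      ← Finset.sum_add_distrib]
    refine Finset.sum_congr rfl fun k _ => ?_
    rw [iteratedDeriv_add (hf.contDiffAt.of_le (by exact_mod_cast le_top))
      (hg.contDiffAt.of_le (by exact_mod_cast le_top)), mul_add]
end

section
/- Let f, g : ℝ → ℝ be smooth, suppose f satisfies a simple differential equation of order ≤ n on ℝ and g satisfies a simple differential equation of order ≤ m on ℝ, with n ≥ 1 and m ≥ 1. Then the pointwise product f·g satisfies a simple differential equation of order ≤ n·m on ℝ. -/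
open Real Finset

section Saturation

variable {R M : Type*} [CommRing R] [IsDomain R] [AddCommGroup M] [Module R M]

/-- The saturation of a submodule: the elements that have a nonzero multiple in it. -/
def Submodule.saturation (N : Submodule R M) : Submodule R M :=
  (Submodule.torsion R (M ⧸ N)).comap N.mkQ

theorem Submodule.mem_saturation {N : Submodule R M} {x : M} :
    x ∈ N.saturation ↔ ∃ q : R, q ≠ 0 ∧ q • x ∈ N := by
  simp only [Submodule.saturation, Submodule.mem_comap, Submodule.mem_torsion_iff, Subtype.exists,
    mem_nonZeroDivisors_iff_ne_zero, Submonoid.mk_smul, exists_prop, Submodule.mkQ_apply,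
    ← Submodule.Quotient.mk_smul, Submodule.Quotient.mk_eq_zero]

theorem Submodule.le_saturation (N : Submodule R M) : N ≤ N.saturation := fun x hx =>
  Submodule.mem_saturation.2 ⟨1, one_ne_zero, by simpa using hx⟩

theorem Submodule.mem_saturation_of_smul_mem {N : Submodule R M} {q : R} (hq : q ≠ 0) {x : M}
    (h : q • x ∈ N.saturation) : x ∈ N.saturation := by
  obtain ⟨r, hr, h⟩ := Submodule.mem_saturation.1 h
  exact Submodule.mem_saturation.2 ⟨r * q, mul_ne_zero hr hq, by rwa [mul_smul]⟩

theorem not_linearIndependent_of_mem_saturation_span {ι : Type*} [Fintype ι] {v : ι → M}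
    {w : Finset M} (hv : ∀ i, v i ∈ (Submodule.span R (w : Set M)).saturation)
    (hw : w.card < Fintype.card ι) : ¬ LinearIndependent R v := by
  intro h
  choose q hq hqv using fun i => Submodule.mem_saturation.1 (hv i)
  have hli : LinearIndependent R (fun i => q i • v i) := by
    rw [Fintype.linearIndependent_iff] at h ⊢
    intro g hg i
    have := h (fun i => g i * q i) (by simpa only [mul_smul] using hg) i
    exact (mul_eq_zero.1 this).resolve_right (hq i)
  have := linearIndependent_le_span_aux' _ hli (w : Set M) (by rintro _ ⟨i, rfl⟩; exact hqv i)
  simp only [Finset.coe_sort_coe, Fintype.card_coe] at this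
  omega

end Saturation

section SaturationMul

variable {R A : Type*} [CommRing R] [IsDomain R] [CommRing A] [Algebra R A]

theorem Submodule.mul_mem_saturation_mul {M N : Submodule R A} {x y : A}
    (hx : x ∈ M.saturation) (hy : y ∈ N.saturation) : x * y ∈ (M * N).saturation := by
  obtain ⟨q, hq, hqx⟩ := Submodule.mem_saturation.1 hx
  obtain ⟨r, hr, hry⟩ := Submodule.mem_saturation.1 hy
  refine Submodule.mem_saturation.2 ⟨q * r, mul_ne_zero hq hr, ?_⟩
  rw [← smul_mul_smul_comm]
  exact Submodule.mul_mem_mul hqx hry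

end SaturationMul

section Derivatives

open Polynomial

attribute [local instance] Polynomial.algebraPi

theorem polynomial_smul_real_apply (p : ℝ[X]) (f : ℝ → ℝ) (x : ℝ) : (p • f) x = p.eval x * f x := by
  rw [polynomial_smul_apply', Polynomial.coe_aeval_eq_eval, smul_eq_mul]

theorem hasDerivAt_polynomial_smul (p : ℝ[X]) {f : ℝ → ℝ} (hf : Differentiable ℝ f) (x : ℝ) :
    HasDerivAt (p • f) ((derivative p • f + p • deriv f) x) x := by
  have h : p • f = fun x => p.eval x * f x := funext (polynomial_smul_real_apply p f)
  rw [h, Pi.add_apply, polynomial_smul_real_apply, polynomial_smul_real_apply]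
  exact (p.hasDerivAt x).mul (hf x).hasDerivAt

theorem deriv_polynomial_smul (p : ℝ[X]) {f : ℝ → ℝ} (hf : Differentiable ℝ f) :
    deriv (p • f) = derivative p • f + p • deriv f :=
  funext fun x => (hasDerivAt_polynomial_smul p hf x).deriv

/-- The `ℝ[X]`-module generated by the derivatives of `f` of order less than `a`. -/
noncomputable def derivSpan (f : ℝ → ℝ) (a : ℕ) : Submodule ℝ[X] (ℝ → ℝ) :=
  Submodule.span ℝ[X] ((fun i => iteratedDeriv i f) '' Set.Iio a)

theorem iteratedDeriv_mem_derivSpan (f : ℝ → ℝ) {a i : ℕ} (hi : i < a) :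
    iteratedDeriv i f ∈ derivSpan f a :=
  Submodule.subset_span ⟨i, hi, rfl⟩

theorem differentiable_and_deriv_mem_saturation {f : ℝ → ℝ} (hf : ContDiff ℝ (⊤ : ℕ∞) f) {a : ℕ}
    (ha : iteratedDeriv a f ∈ (derivSpan f a).saturation) {h : ℝ → ℝ} (hh : h ∈ derivSpan f a) :
    Differentiable ℝ h ∧ deriv h ∈ (derivSpan f a).saturation := by
  induction hh using Submodule.span_induction with
  | mem h hh =>
    obtain ⟨i, hi, rfl⟩ := hh
    refine ⟨hf.differentiable_iteratedDeriv i (by exact_mod_cast WithTop.coe_lt_top i), ?_⟩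
    simp only [← iteratedDeriv_succ]
    rcases (Nat.succ_le_of_lt hi).lt_or_eq with h | h
    · exact Submodule.le_saturation _ (iteratedDeriv_mem_derivSpan f h)
    · rwa [← Nat.succ_eq_add_one, h]
  | zero => exact ⟨differentiable_const 0, by simp⟩
  | add u v _ _ hu hv =>
    refine ⟨hu.1.add hv.1, ?_⟩
    rw [show deriv (u + v) = deriv u + deriv v from funext fun x => deriv_add (hu.1 x) (hv.1 x)]
    exact add_mem hu.2 hv.2
  | smul p u hmem hu =>
    refine ⟨fun x => (hasDerivAt_polynomial_smul p hu.1 x).differentiableAt, ?_⟩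
    rw [deriv_polynomial_smul p hu.1]
    exact add_mem (Submodule.le_saturation _ (Submodule.smul_mem _ _ hmem))
      (Submodule.smul_mem _ _ hu.2)

theorem iteratedDeriv_mem_saturation {f : ℝ → ℝ} (hf : ContDiff ℝ (⊤ : ℕ∞) f) {a : ℕ}
    (ha : iteratedDeriv a f ∈ (derivSpan f a).saturation) (k : ℕ) :
    iteratedDeriv k f ∈ (derivSpan f a).saturation := by
  induction k with
  | zero =>
    rcases a.eq_zero_or_pos with rfl | h
    · exact ha
    · exact Submodule.le_saturation _ (iteratedDeriv_mem_derivSpan f h)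
  | succ k ih =>
    obtain ⟨q, hq, hmem⟩ := Submodule.mem_saturation.1 ih
    have hd := (differentiable_and_deriv_mem_saturation hf ha hmem).2
    rw [deriv_polynomial_smul q
      (hf.differentiable_iteratedDeriv k (by exact_mod_cast WithTop.coe_lt_top k)),
      ← iteratedDeriv_succ] at hd
    exact Submodule.mem_saturation_of_smul_mem hq
      ((Submodule.add_mem_iff_right _ (Submodule.smul_mem _ _ ih)).1 hd)

theorem SimpleDE.exists_iteratedDeriv_mem_saturation {f : ℝ → ℝ} {n : ℕ}
    (h : SimpleDE f n Set.univ) :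
    ∃ a ≤ n, iteratedDeriv a f ∈ (derivSpan f a).saturation := by
  classical
  obtain ⟨p, ⟨k, hk, hpk⟩, hp⟩ := h
  set a := Nat.findGreatest (fun k => p k ≠ 0) n with ha
  have han : a ≤ n := Nat.findGreatest_le n
  have hpa : p a ≠ 0 := Nat.findGreatest_spec (P := fun k => p k ≠ 0) hk hpk
  refine ⟨a, han, Submodule.mem_saturation.2 ⟨p a, hpa, ?_⟩⟩
  have hsum : ∑ k ∈ Finset.range (a + 1), p k • iteratedDeriv k f = 0 := by
    rw [Finset.sum_subset (Finset.range_mono (Nat.succ_le_succ han))]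
    · ext x
      simpa only [Finset.sum_apply, polynomial_smul_real_apply, Pi.zero_apply] using hp x (Set.mem_univ x)
    · intro j hj hja
      rw [Finset.mem_range] at hj hja
      have : ¬ p j ≠ 0 := Nat.findGreatest_is_greatest (P := fun k => p k ≠ 0)
        (show a < j by omega) (by omega)
      rw [not_not.1 this, zero_smul]
  rw [Finset.sum_range_succ, add_comm] at hsum
  rw [eq_neg_of_add_eq_zero_left hsum]
  exact neg_mem (sum_mem fun i hi => Submodule.smul_mem _ _
    (iteratedDeriv_mem_derivSpan f (Finset.mem_range.1 hi)))

theorem iteratedDeriv_mul_mem_saturation {f g : ℝ → ℝ} (hf : ContDiff ℝ (⊤ : ℕ∞) f)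
    (hg : ContDiff ℝ (⊤ : ℕ∞) g) {a b : ℕ}
    (ha : iteratedDeriv a f ∈ (derivSpan f a).saturation)
    (hb : iteratedDeriv b g ∈ (derivSpan g b).saturation) (k : ℕ) :
    iteratedDeriv k (f * g) ∈ (derivSpan f a * derivSpan g b).saturation := by
  have h : iteratedDeriv k (f * g) = ∑ i ∈ Finset.range (k + 1),
      k.choose i • (iteratedDeriv i f * iteratedDeriv (k - i) g) := by
    ext x
    rw [iteratedDeriv_mul (hf.contDiffAt.of_le (by exact_mod_cast le_top))
      (hg.contDiffAt.of_le (by exact_mod_cast le_top))]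
    simp [mul_assoc]
  rw [h]
  exact sum_mem fun i _ => nsmul_mem (Submodule.mul_mem_saturation_mul
    (iteratedDeriv_mem_saturation hf ha _) (iteratedDeriv_mem_saturation hg hb _)) _

theorem exists_finset_span_eq_derivSpan_mul (f g : ℝ → ℝ) (a b : ℕ) :
    ∃ w : Finset (ℝ → ℝ), w.card ≤ a * b ∧
      Submodule.span ℝ[X] (w : Set (ℝ → ℝ)) = derivSpan f a * derivSpan g b := by
  classical
  refine ⟨Finset.image₂ (fun i j => iteratedDeriv i f * iteratedDeriv j g)
    (Finset.range a) (Finset.range b), ?_, ?_⟩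
  · simpa using Finset.card_image₂_le (fun i j => iteratedDeriv i f * iteratedDeriv j g)
      (Finset.range a) (Finset.range b)
  · rw [derivSpan, derivSpan, Submodule.span_mul_span, Finset.coe_image₂, Finset.coe_range,
      Finset.coe_range, ← Set.image2_mul, Set.image2_image_left, Set.image2_image_right]

theorem simpleDE_of_not_linearIndependent {f : ℝ → ℝ} {n : ℕ}
    (h : ¬ LinearIndependent ℝ[X] (fun k : Fin (n + 1) => iteratedDeriv k f)) :
    SimpleDE f n Set.univ := by
  obtain ⟨c, hc, i, hi⟩ := Fintype.not_linearIndependent_iff.1 h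
  refine ⟨fun k => if hk : k < n + 1 then c ⟨k, hk⟩ else 0,
    ⟨i, Nat.lt_succ_iff.1 i.2, by simpa only [i.2, dite_true] using hi⟩, fun x _ => ?_⟩
  rw [Finset.sum_range]
  simpa only [Fin.is_lt, dite_true, Finset.sum_apply, polynomial_smul_real_apply,
    Pi.zero_apply] using congrFun hc x

end Derivatives

theorem simpleDE_mul (f g : ℝ → ℝ) (hf : ContDiff ℝ (⊤ : ℕ∞) f) (hg : ContDiff ℝ (⊤ : ℕ∞) g)
    (n m : ℕ) (hn : 1 ≤ n) (hm : 1 ≤ m)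
    (hfDE : SimpleDE f n Set.univ) (hgDE : SimpleDE g m Set.univ) :
    SimpleDE (f * g) (n * m) Set.univ := by
  let := Polynomial.algebraPi ℝ ℝ ℝ
  obtain ⟨a, han, ha⟩ := hfDE.exists_iteratedDeriv_mem_saturation
  obtain ⟨b, hbm, hb⟩ := hgDE.exists_iteratedDeriv_mem_saturation
  obtain ⟨w, hw, hspan⟩ := exists_finset_span_eq_derivSpan_mul f g a b
  refine simpleDE_of_not_linearIndependent
    (not_linearIndependent_of_mem_saturation_span (w := w) (fun k => ?_) ?_)
  · rw [hspan]
    exact iteratedDeriv_mul_mem_saturation hf hg ha hb k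
  · rw [Fintype.card_fin]
    exact Nat.lt_succ_of_le (hw.trans (Nat.mul_le_mul han hbm))
end

section
/- Let f : ℝ → ℝ be smooth and suppose f satisfies a simple differential equation of order ≤ n on ℝ with n ≥ 1. Let p and q be real polynomials with q not the zero polynomial, and let U = {x ∈ ℝ : q(x) ≠ 0}. Then the composition h : ℝ → ℝ, defined on U by h(x) = f(p(x)/q(x)), satisfies a simple differential equation of order ≤ n on U. -/
open Real Finset

/-- The coefficient of the `k`-th derivative in the linear differential operator with polynomial
coefficients that sends `f ∘ r` to `w ^ (2 * j)` times the composition of the `j`-th derivative of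
`f` with `r`, for a function `r` with derivative `w / q ^ 2`. -/
noncomputable def pullbackCoeff (q w : Polynomial ℝ) : ℕ → ℕ → Polynomial ℝ
  | 0, 0 => 1
  | 0, _ + 1 => 0
  | j + 1, 0 => q ^ 2 * w * (pullbackCoeff q w j 0).derivative
      - Polynomial.C (2 * j : ℝ) * q ^ 2 * w.derivative * pullbackCoeff q w j 0
  | j + 1, k + 1 => q ^ 2 * w * ((pullbackCoeff q w j (k + 1)).derivative + pullbackCoeff q w j k)
      - Polynomial.C (2 * j : ℝ) * q ^ 2 * w.derivative * pullbackCoeff q w j (k + 1)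

lemma pullbackCoeff_eq_zero_of_lt (q w : Polynomial ℝ) {j k : ℕ} (hjk : j < k) :
    pullbackCoeff q w j k = 0 := by
  induction j generalizing k with
  | zero => obtain ⟨k, rfl⟩ := Nat.exists_eq_succ_of_ne_zero hjk.ne'; simp [pullbackCoeff]
  | succ j ih =>
    obtain ⟨k, rfl⟩ := Nat.exists_eq_succ_of_ne_zero (Nat.ne_zero_of_lt hjk)
    simp [pullbackCoeff, ih (show j < k + 1 by omega), ih (show j < k by omega)]

lemma pullbackCoeff_self (q w : Polynomial ℝ) (j : ℕ) :
    pullbackCoeff q w j j = (q ^ 2 * w) ^ j := by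
  induction j with
  | zero => simp [pullbackCoeff]
  | succ j ih =>
    simp [pullbackCoeff, ih, pullbackCoeff_eq_zero_of_lt q w (Nat.lt_succ_self j)]
    ring

lemma isOpen_eval_ne_zero (q : Polynomial ℝ) : IsOpen {x : ℝ | q.eval x ≠ 0} :=
  isOpen_ne_fun q.continuous continuous_const

lemma hasDerivAt_eval_div_eval (p q : Polynomial ℝ) {x : ℝ} (hx : q.eval x ≠ 0) :
    HasDerivAt (fun y => p.eval y / q.eval y)
      ((p.derivative * q - p * q.derivative).eval x / q.eval x ^ 2) x := by
  simpa using (p.hasDerivAt x).fun_div (q.hasDerivAt x) hx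

lemma hasDerivAt_iteratedDeriv_of_contDiffOn {h : ℝ → ℝ} {U : Set ℝ} (hU : IsOpen U)
    (hh : ContDiffOn ℝ (⊤ : ℕ∞) h U) (k : ℕ) {x : ℝ} (hx : x ∈ U) :
    HasDerivAt (iteratedDeriv k h) (iteratedDeriv (k + 1) h x) x := by
  have hd : DifferentiableOn ℝ (iteratedDerivWithin k h U) U :=
    hh.differentiableOn_iteratedDerivWithin (by exact_mod_cast ENat.natCast_lt_top k) hU.uniqueDiffOn
  have hd' := (hd.congr fun y hy => (iteratedDerivWithin_of_isOpen hU hy).symm).differentiableAt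
    (hU.mem_nhds hx)
  rw [iteratedDeriv_succ]
  exact hd'.hasDerivAt

/-- The derivatives of `f` along a rational function `p / q` are, up to powers of the numerator of
`(p / q)'`, polynomial combinations of the derivatives of `h = f ∘ (p / q)`. -/
lemma sum_pullbackCoeff_mul_iteratedDeriv {f h : ℝ → ℝ} {p q w : Polynomial ℝ}
    (hw : w = p.derivative * q - p * q.derivative) (hf : ContDiff ℝ (⊤ : ℕ∞) f)
    (hs : ContDiffOn ℝ (⊤ : ℕ∞) h {x : ℝ | q.eval x ≠ 0})
    (hh : ∀ x ∈ {x : ℝ | q.eval x ≠ 0}, h x = f (p.eval x / q.eval x)) {j m : ℕ} (hjm : j < m)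
    {x : ℝ} (hx : q.eval x ≠ 0) :
    ∑ k ∈ range m, (pullbackCoeff q w j k).eval x * iteratedDeriv k h x
      = w.eval x ^ (2 * j) * iteratedDeriv j f (p.eval x / q.eval x) := by
  induction j generalizing m x with
  | zero =>
    obtain ⟨m, rfl⟩ := Nat.exists_eq_succ_of_ne_zero hjm.ne'
    rw [sum_range_succ']
    simp [pullbackCoeff, hh x hx]
  | succ j ih =>
    obtain ⟨m, rfl⟩ := Nat.exists_eq_succ_of_ne_zero (Nat.ne_zero_of_lt hjm)
    have hU := isOpen_eval_ne_zero q
    have hL : HasDerivAt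
        (fun y => ∑ k ∈ range m, (pullbackCoeff q w j k).eval y * iteratedDeriv k h y)
        (∑ k ∈ range m, ((pullbackCoeff q w j k).derivative.eval x * iteratedDeriv k h x
          + (pullbackCoeff q w j k).eval x * iteratedDeriv (k + 1) h x)) x :=
      HasDerivAt.fun_sum fun k _ => ((pullbackCoeff q w j k).hasDerivAt x).mul
        (hasDerivAt_iteratedDeriv_of_contDiffOn hU hs k hx)
    have hg : HasDerivAt (fun y => iteratedDeriv j f (p.eval y / q.eval y))
        (iteratedDeriv (j + 1) f (p.eval x / q.eval x) * (w.eval x / q.eval x ^ 2)) x := by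
      rw [hw]
      exact (hasDerivAt_iteratedDeriv_of_contDiffOn isOpen_univ hf.contDiffOn j
        (Set.mem_univ _)).comp x (hasDerivAt_eval_div_eval p q hx)
    have hR := ((w.hasDerivAt x).fun_pow (2 * j)).mul hg
    have key := (hL.congr_of_eventuallyEq (Filter.eventually_of_mem (hU.mem_nhds hx)
      fun y hy => (ih (show j < m by omega) hy).symm)).unique hR
    have h0 := ih (show j < m + 1 by omega) hx
    have hD : ∑ k ∈ range (m + 1), (pullbackCoeff q w j k).derivative.eval x * iteratedDeriv k h x
        = ∑ k ∈ range m, (pullbackCoeff q w j k).derivative.eval x * iteratedDeriv k h x := by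
      rw [sum_range_succ, pullbackCoeff_eq_zero_of_lt q w (show j < m by omega)]
      simp
    have hpow : (2 * j : ℝ) * w.eval x ^ (2 * j - 1) * w.eval x = 2 * j * w.eval x ^ (2 * j) := by
      rcases j with _ | j
      · simp
      · rw [mul_assoc, ← pow_succ]; congr 2
    have hsplit : ∑ k ∈ range (m + 1), (pullbackCoeff q w (j + 1) k).eval x * iteratedDeriv k h x
        = (q.eval x ^ 2 * w.eval x) * (∑ k ∈ range (m + 1),
            (pullbackCoeff q w j k).derivative.eval x * iteratedDeriv k h x
          + ∑ k ∈ range m, (pullbackCoeff q w j k).eval x * iteratedDeriv (k + 1) h x)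
          - 2 * j * q.eval x ^ 2 * w.derivative.eval x * ∑ k ∈ range (m + 1),
            (pullbackCoeff q w j k).eval x * iteratedDeriv k h x := by
      have htail : ∑ k ∈ range m, (pullbackCoeff q w (j + 1) (k + 1)).eval x
            * iteratedDeriv (k + 1) h x
          = (q.eval x ^ 2 * w.eval x) * (∑ k ∈ range m,
              (pullbackCoeff q w j (k + 1)).derivative.eval x * iteratedDeriv (k + 1) h x
            + ∑ k ∈ range m, (pullbackCoeff q w j k).eval x * iteratedDeriv (k + 1) h x)
            - 2 * j * q.eval x ^ 2 * w.derivative.eval x * ∑ k ∈ range m,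
              (pullbackCoeff q w j (k + 1)).eval x * iteratedDeriv (k + 1) h x := by
        rw [← sum_add_distrib, mul_sum, mul_sum, ← sum_sub_distrib]
        refine sum_congr rfl fun k _ => ?_
        simp [pullbackCoeff]
        ring
      rw [sum_range_succ', sum_range_succ' _ m, sum_range_succ' _ m, htail]
      simp [pullbackCoeff]
      ring
    rw [hsplit, hD, ← sum_add_distrib, key, h0]
    push_cast
    have hc : q.eval x ^ 2 * (w.eval x / q.eval x ^ 2) = w.eval x :=
      mul_div_cancel₀ _ (pow_ne_zero 2 hx)
    linear_combination (q.eval x ^ 2 * w.derivative.eval x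
        * iteratedDeriv j f (p.eval x / q.eval x)) * hpow
      + (w.eval x ^ (2 * j + 1) * iteratedDeriv (j + 1) f (p.eval x / q.eval x)) * hc

/-- The polynomial `q ^ N * P (p / q)`, for `N` at least the degree of `P`. -/
noncomputable def clearDenom (p q : Polynomial ℝ) (N : ℕ) (P : Polynomial ℝ) : Polynomial ℝ :=
  ∑ i ∈ range (N + 1), Polynomial.C (P.coeff i) * p ^ i * q ^ (N - i)

lemma eval_clearDenom {P p q : Polynomial ℝ} {N : ℕ} (hN : P.natDegree ≤ N) {x : ℝ}
    (hx : q.eval x ≠ 0) :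
    (clearDenom p q N P).eval x = q.eval x ^ N * P.eval (p.eval x / q.eval x) := by
  rw [clearDenom, Polynomial.eval_eq_sum_range' (Nat.lt_succ_of_le hN), Polynomial.eval_finsetSum,
    mul_sum]
  refine sum_congr rfl fun i hi => ?_
  have hi' : i ≤ N := by simpa [Nat.lt_succ_iff] using hi
  obtain ⟨d, rfl⟩ := Nat.exists_eq_add_of_le hi'
  simp only [Polynomial.eval_mul, Polynomial.eval_C, Polynomial.eval_pow, Nat.add_sub_cancel_left,
    div_pow, pow_add]
  field_simp

/-- A nonconstant rational function is not a root of a nonzero polynomial. -/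
lemma exists_eval_div_ne_zero {P p q : Polynomial ℝ} (hP : P ≠ 0) (hq : q ≠ 0)
    (hw : p.derivative * q - p * q.derivative ≠ 0) :
    ∃ x, q.eval x ≠ 0 ∧ P.eval (p.eval x / q.eval x) ≠ 0 := by
  by_contra! hcon
  have hfac : q * ∏ c ∈ P.roots.toFinset, (p - Polynomial.C c * q) = 0 := by
    refine Polynomial.funext fun x => ?_
    by_cases hx : q.eval x = 0
    · simp [hx]
    · rw [Polynomial.eval_mul, Polynomial.eval_prod, Polynomial.eval_zero]
      refine mul_eq_zero_of_right _ (prod_eq_zero (i := p.eval x / q.eval x) ?_ ?_)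
      · simpa [hP] using hcon x hx
      · simp [hx]
  rcases mul_eq_zero.1 hfac with h | h
  · exact hq h
  · obtain ⟨c, -, hc⟩ := prod_eq_zero_iff.1 h
    apply hw
    rw [sub_eq_zero.1 hc]
    simp
    ring

theorem simpleDE_rational_comp (f : ℝ → ℝ) (hf : ContDiff ℝ (⊤ : ℕ∞) f) (n : ℕ) (hn : 1 ≤ n)
    (hDE : SimpleDE f n Set.univ) (p q : Polynomial ℝ) (hq : q ≠ 0)
    (h : ℝ → ℝ)
    (hh : ∀ x ∈ {x : ℝ | q.eval x ≠ 0}, h x = f (p.eval x / q.eval x)) :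
    SimpleDE h n {x : ℝ | q.eval x ≠ 0} := by
  obtain ⟨P, hP, hsum⟩ := hDE
  have hU := isOpen_eval_ne_zero q
  obtain ⟨w, hw⟩ : ∃ w, w = p.derivative * q - p * q.derivative := ⟨_, rfl⟩
  have hpoly : ∀ a : Polynomial ℝ, ContDiff ℝ (⊤ : ℕ∞) fun x : ℝ => a.eval x := fun a => by
    simpa using a.contDiff_aeval (𝕜 := ℝ) (⊤ : ℕ∞)
  have hs : ContDiffOn ℝ (⊤ : ℕ∞) h {x : ℝ | q.eval x ≠ 0} :=
    (hf.comp_contDiffOn ((hpoly p).contDiffOn.div (hpoly q).contDiffOn fun x hx => hx)).congr hh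
  by_cases hw0 : w = 0
  · refine ⟨fun k => if k = 1 then 1 else 0, ⟨1, hn, by simp⟩, fun x hx => ?_⟩
    have hd : HasDerivAt h 0 x := by
      have hc := ((hf.differentiable (by simp)).differentiableAt.hasDerivAt.comp x
        (hasDerivAt_eval_div_eval p q hx)).congr_of_eventuallyEq
        (Filter.eventually_of_mem (hU.mem_nhds hx) hh)
      simpa [← hw, hw0] using hc
    refine sum_eq_zero fun k _ => ?_
    rcases eq_or_ne k 1 with rfl | hk
    · simp [iteratedDeriv_one, hd.deriv]
    · simp [hk]
  set N := (range (n + 1)).sup fun i => (P i).natDegree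
  have hR : ∀ j ∈ range (n + 1), ∀ {x}, q.eval x ≠ 0 → (clearDenom p q N (P j)).eval x =
      q.eval x ^ N * (P j).eval (p.eval x / q.eval x) := fun j hj x hx =>
    eval_clearDenom (le_sup (f := fun i => (P i).natDegree) hj) hx
  refine ⟨fun k => ∑ j ∈ range (n + 1),
    clearDenom p q N (P j) * w ^ (2 * (n - j)) * pullbackCoeff q w j k, ?_, fun x hx => ?_⟩
  · classical
    obtain ⟨k, hk, hPk⟩ := hP
    have hJ : P (Nat.findGreatest (fun j => P j ≠ 0) n) ≠ 0 :=
      Nat.findGreatest_spec (P := fun j => P j ≠ 0) hk hPk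
    have hJn : Nat.findGreatest (fun j => P j ≠ 0) n ≤ n := Nat.findGreatest_le n
    have hmax : ∀ j ≤ n, Nat.findGreatest (fun j => P j ≠ 0) n < j → P j = 0 :=
      fun j hj hlt => not_not.1 (Nat.findGreatest_is_greatest hlt hj)
    generalize Nat.findGreatest (fun j => P j ≠ 0) n = J at hJ hJn hmax
    have hJr : J ∈ range (n + 1) := mem_range.2 (Nat.lt_succ_of_le hJn)
    refine ⟨J, hJn, ?_⟩
    beta_reduce
    rw [sum_eq_single_of_mem J hJr, pullbackCoeff_self]
    · obtain ⟨x, hx, hPx⟩ := exists_eval_div_ne_zero hJ hq (hw ▸ hw0)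
      have hRJ : clearDenom p q N (P J) ≠ 0 := fun h0 => by
        have hRx := hR J hJr hx
        rw [h0, Polynomial.eval_zero] at hRx
        exact mul_ne_zero (pow_ne_zero _ hx) hPx hRx.symm
      exact mul_ne_zero (mul_ne_zero hRJ (pow_ne_zero _ hw0))
        (pow_ne_zero _ (mul_ne_zero (pow_ne_zero _ hq) hw0))
    · intro j hj hne
      rcases hne.lt_or_gt with hlt | hgt
      · simp [pullbackCoeff_eq_zero_of_lt q w hlt]
      · simp [clearDenom, hmax j (Nat.lt_succ_iff.1 (mem_range.1 hj)) hgt]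
  · simp only [Polynomial.eval_finsetSum, Polynomial.eval_mul, Polynomial.eval_pow, sum_mul]
    rw [sum_comm]
    simp only [mul_assoc, ← mul_sum]
    calc _ = w.eval x ^ (2 * n) * (q.eval x ^ N * ∑ j ∈ range (n + 1),
          (P j).eval (p.eval x / q.eval x) * iteratedDeriv j f (p.eval x / q.eval x)) := by
          rw [mul_sum, mul_sum]
          refine sum_congr rfl fun j hj => ?_
          have hj' : j ≤ n := by simpa [Nat.lt_succ_iff] using hj
          have hwn : w.eval x ^ (2 * n) = w.eval x ^ (2 * (n - j)) * w.eval x ^ (2 * j) := by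
            rw [← pow_add]
            congr 1
            omega
          rw [sum_pullbackCoeff_mul_iteratedDeriv hw hf hs hh (Nat.lt_succ_of_le hj') hx,
            hR j hj hx, hwn]
          ring
      _ = 0 := by rw [hsum _ (Set.mem_univ _), mul_zero, mul_zero]
end

section
/- Let f : ℝ → ℝ be smooth and suppose f satisfies a simple differential equation of order ≤ n on ℝ with n ≥ 1. Then the pointwise square f² satisfies a simple differential equation of order ≤ n(n+1)/2 on ℝ. -/
open Real Finset

attribute [local instance] Polynomial.algebraPi

theorem polynomialEval_smul_apply (a : Polynomial ℝ) (h : ℝ → ℝ) (x : ℝ) :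
    (a • h) x = a.eval x * h x := rfl

theorem Differentiable.polynomial_smul {h : ℝ → ℝ} (hh : Differentiable ℝ h)
    (a : Polynomial ℝ) : Differentiable ℝ (a • h) :=
  a.differentiable.mul hh

theorem deriv_polynomial_smul_s17 {h : ℝ → ℝ} (hh : Differentiable ℝ h) (a : Polynomial ℝ) :
    deriv (a • h) = Polynomial.derivative a • h + a • deriv h := by
  funext x
  exact ((a.hasDerivAt x).mul (hh x).hasDerivAt).deriv

/-- A module of differentiable functions which is stable under `p · d/dx`. -/
def StableUnderDeriv (p : Polynomial ℝ) (T : Submodule (Polynomial ℝ) (ℝ → ℝ)) : Prop :=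
  ∀ h ∈ T, Differentiable ℝ h ∧ p • deriv h ∈ T

theorem stableUnderDeriv_span {p : Polynomial ℝ} {G : Set (ℝ → ℝ)}
    (hG : ∀ g ∈ G, Differentiable ℝ g ∧ p • deriv g ∈ Submodule.span (Polynomial ℝ) G) :
    StableUnderDeriv p (Submodule.span (Polynomial ℝ) G) := by
  intro h hh
  induction hh using Submodule.span_induction with
  | mem g hg => exact hG g hg
  | zero =>
    refine ⟨differentiable_const 0, ?_⟩
    have : deriv (0 : ℝ → ℝ) = 0 := deriv_const' 0
    rw [this, smul_zero]
    exact zero_mem _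
  | add g h _ _ ihg ihh =>
    refine ⟨ihg.1.add ihh.1, ?_⟩
    have : deriv (g + h) = deriv g + deriv h := funext fun x => deriv_add (ihg.1 x) (ihh.1 x)
    rw [this, smul_add]
    exact add_mem ihg.2 ihh.2
  | smul a h hmem ih =>
    refine ⟨ih.1.polynomial_smul a, ?_⟩
    rw [deriv_polynomial_smul_s17 ih.1, smul_add, smul_smul, smul_comm p a]
    exact add_mem (Submodule.smul_mem _ _ hmem) (Submodule.smul_mem _ _ ih.2)

theorem StableUnderDeriv.mul {p : Polynomial ℝ} {T : Submodule (Polynomial ℝ) (ℝ → ℝ)}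
    (hT : StableUnderDeriv p T) : StableUnderDeriv p (T * T) := by
  intro h hh
  induction hh using Submodule.mul_induction_on' with
  | mem_mul_mem g hg h hh =>
    obtain ⟨dg, sg⟩ := hT g hg
    obtain ⟨dh, sh⟩ := hT h hh
    refine ⟨dg.mul dh, ?_⟩
    have : deriv (g * h) = deriv g * h + g * deriv h := funext fun x => deriv_mul (dg x) (dh x)
    rw [this, smul_add, ← smul_mul_assoc, ← mul_smul_comm]
    exact add_mem (Submodule.mul_mem_mul sg hh) (Submodule.mul_mem_mul hg sh)
  | add g _ h _ ihg ihh =>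
    refine ⟨ihg.1.add ihh.1, ?_⟩
    have : deriv (g + h) = deriv g + deriv h := funext fun x => deriv_add (ihg.1 x) (ihh.1 x)
    rw [this, smul_add]
    exact add_mem ihg.2 ihh.2

theorem StableUnderDeriv.pow_smul_iteratedDeriv_mem {p : Polynomial ℝ}
    {S : Submodule (Polynomial ℝ) (ℝ → ℝ)} (hS : StableUnderDeriv p S) {u : ℝ → ℝ}
    (hu : ContDiff ℝ (⊤ : ℕ∞) u) {r : ℕ} (hr : p ^ r • u ∈ S) (k : ℕ) :
    p ^ (r + k) • iteratedDeriv k u ∈ S := by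
  induction k with
  | zero => simpa using hr
  | succ k ih =>
    have hd : Differentiable ℝ (iteratedDeriv k u) :=
      hu.differentiable_iteratedDeriv k (by exact_mod_cast WithTop.coe_lt_top k)
    have h := (hS _ ih).2
    rw [deriv_polynomial_smul_s17 hd, smul_add, ← iteratedDeriv_succ, smul_smul p (p ^ (r + k)),
      ← pow_succ'] at h
    refine (Submodule.add_mem_iff_right _ ?_).1 h
    rw [smul_smul, Polynomial.derivative_pow]
    rcases Nat.eq_zero_or_pos (r + k) with h0 | h0
    · rw [h0]
      simp
    · obtain ⟨l, hl⟩ := Nat.exists_eq_succ_of_ne_zero h0.ne'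
      have : p * (Polynomial.C ((r + k : ℕ) : ℝ) * p ^ (r + k - 1) * Polynomial.derivative p) =
          (Polynomial.C ((r + k : ℕ) : ℝ) * Polynomial.derivative p) * p ^ (r + k) := by
        rw [hl, Nat.succ_sub_one, pow_succ]
        ring
      rw [this, ← smul_smul]
      exact Submodule.smul_mem _ _ ih

theorem span_range_mul_self_le (m : ℕ) (F : Fin m → ℝ → ℝ) :
    Submodule.span (Polynomial ℝ) (Set.range F) * Submodule.span (Polynomial ℝ) (Set.range F) ≤
      Submodule.span (Polynomial ℝ) (Set.range fun s : Sym2 (Fin m) => (s.map F).mul) := by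
  rw [Submodule.span_mul_span]
  refine Submodule.span_mono ?_
  rintro _ ⟨_, ⟨i, rfl⟩, _, ⟨j, rfl⟩, rfl⟩
  exact ⟨s(i, j), rfl⟩

/-- The leading coefficient may be assumed nonzero, after lowering the order. -/
theorem SimpleDE.exists_leading {f : ℝ → ℝ} {n : ℕ} {S : Set ℝ} (h : SimpleDE f n S) :
    ∃ m ≤ n, ∃ p : ℕ → Polynomial ℝ, p m ≠ 0 ∧
      ∀ x ∈ S, ∑ k ∈ Finset.range (m + 1), (p k).eval x * iteratedDeriv k f x = 0 := by
  obtain ⟨p, hne, hp⟩ := h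
  induction n with
  | zero =>
    obtain ⟨k, hk, hpk⟩ := hne
    obtain rfl : k = 0 := by omega
    exact ⟨0, le_rfl, p, hpk, hp⟩
  | succ n ih =>
    by_cases h0 : p (n + 1) = 0
    · obtain ⟨k, hk, hpk⟩ := hne
      have hkn : k ≠ n + 1 := by
        rintro rfl
        exact hpk h0
      obtain ⟨m, hm, hq⟩ := ih ⟨k, by omega, hpk⟩ fun x hx => by
        simpa [Finset.sum_range_succ _ (n + 1), h0] using hp x hx
      exact ⟨m, by omega, hq⟩
    · exact ⟨n + 1, le_rfl, p, h0, hp⟩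

/-- Sequences of functions confined to a module with `N` generators are linearly dependent. -/
theorem simpleDE_of_pow_smul_mem {p : Polynomial ℝ} (hp : p ≠ 0) {r N : ℕ} {u : ℝ → ℝ}
    {w : Set (ℝ → ℝ)} [Fintype w] (hw : Fintype.card w ≤ N)
    (hu : ∀ k, p ^ (r + k) • iteratedDeriv k u ∈ Submodule.span (Polynomial ℝ) w) :
    SimpleDE u N Set.univ := by
  have hdep : ¬ LinearIndependent (Polynomial ℝ)
      (fun k : Fin (N + 1) => p ^ (r + (k : ℕ)) • iteratedDeriv k u) := by
    intro hli
    have hcard := linearIndependent_le_span_aux' _ hli w (by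
      rintro _ ⟨k, rfl⟩
      exact hu k)
    rw [Fintype.card_fin] at hcard
    omega
  rw [Fintype.not_linearIndependent_iff] at hdep
  obtain ⟨q, hq, i, hi⟩ := hdep
  refine ⟨fun k => if hk : k < N + 1 then q ⟨k, hk⟩ * p ^ (r + k) else 0,
    ⟨i, by omega, by simp [Nat.le_of_lt_succ i.2, hi, hp]⟩, fun x _ => ?_⟩
  have hx := congrFun hq x
  simp only [Finset.sum_apply, polynomialEval_smul_apply, Pi.zero_apply] at hx
  rw [Finset.sum_range, ← hx]
  refine Finset.sum_congr rfl fun k _ => ?_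
  simp [Nat.le_of_lt_succ k.2, mul_assoc]

theorem simpleDE_sq (f : ℝ → ℝ) (hf : ContDiff ℝ (⊤ : ℕ∞) f) (n : ℕ) (hn : 1 ≤ n)
    (hDE : SimpleDE f n Set.univ) :
    SimpleDE (fun x => f x ^ 2) (n * (n + 1) / 2) Set.univ := by
  classical
  obtain ⟨m, hmn, p, hpm, hp⟩ := hDE.exists_leading
  set F : Fin m → ℝ → ℝ := fun i => iteratedDeriv i f with hF
  set T := Submodule.span (Polynomial ℝ) (Set.range F)
  have hmem : ∀ i < m, iteratedDeriv i f ∈ T := fun i hi => Submodule.subset_span ⟨⟨i, hi⟩, rfl⟩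
  have hsmul : ∀ i ≤ m, p m • iteratedDeriv i f ∈ T := by
    intro i hi
    rcases hi.lt_or_eq with hi | rfl
    · exact Submodule.smul_mem _ _ (hmem i hi)
    · have : p i • iteratedDeriv i f = -∑ k ∈ Finset.range i, p k • iteratedDeriv k f := by
        funext x
        have hx := hp x trivial
        rw [Finset.sum_range_succ] at hx
        simp only [polynomialEval_smul_apply, Pi.neg_apply, Finset.sum_apply]
        linarith
      rw [this]
      exact neg_mem (sum_mem fun k hk => Submodule.smul_mem _ _ (hmem k (Finset.mem_range.1 hk)))
  have hstable : StableUnderDeriv (p m) T := by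
    refine stableUnderDeriv_span ?_
    rintro _ ⟨i, rfl⟩
    refine ⟨hf.differentiable_iteratedDeriv i (by exact_mod_cast WithTop.coe_lt_top (i : ℕ)), ?_⟩
    rw [hF, ← iteratedDeriv_succ]
    exact hsmul _ i.2
  have hsq : p m ^ 2 • (fun x => f x ^ 2) ∈ T * T := by
    have h0 := hsmul 0 (Nat.zero_le m)
    rw [iteratedDeriv_zero] at h0
    convert Submodule.mul_mem_mul h0 h0 using 1
    funext x
    simp only [polynomialEval_smul_apply, Pi.mul_apply, Polynomial.eval_pow]
    ring
  have hcard : Fintype.card (Set.range fun s : Sym2 (Fin m) => (s.map F).mul) ≤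
      n * (n + 1) / 2 := by
    refine (Fintype.card_range_le _).trans ?_
    rw [Sym2.card, Fintype.card_fin, Nat.choose_two_right, Nat.add_sub_cancel, mul_comm]
    exact Nat.div_le_div_right (Nat.mul_le_mul hmn (by omega))
  exact simpleDE_of_pow_smul_mem hpm hcard fun k => span_range_mul_self_le m F
    (hstable.mul.pow_smul_iteratedDeriv_mem (hf.pow 2) hsq k)
end

section
/- For n ∈ ℕ with n ≥ 1, define f_n : ℝ → ℝ by f_n(x) = ∑_{k=1}^n exp(x^k). Then f_n is simple of exact order n on ℝ, and the pointwise square f_n² is simple of exact order n(n+1)/2 on ℝ. -/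
open Real Finset

/-- `f` is simple of exact order `n` on `S`. -/
def ExactOrder (f : ℝ → ℝ) (n : ℕ) (S : Set ℝ) : Prop :=
  SimpleDE f n S ∧ ¬ SimpleDE f (n - 1) S

section

open Polynomial

/-- The polynomial `r` with `(exp q)^{(k)} = r * exp q`. -/
noncomputable def expDerivCoeff (q : ℝ[X]) (k : ℕ) : ℝ[X] :=
  (fun r => derivative r + derivative q * r)^[k] 1

theorem expDerivCoeff_zero (q : ℝ[X]) : expDerivCoeff q 0 = 1 := rfl

theorem expDerivCoeff_succ (q : ℝ[X]) (k : ℕ) :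
    expDerivCoeff q (k + 1) =
      derivative (expDerivCoeff q k) + derivative q * expDerivCoeff q k := by
  simp only [expDerivCoeff, Function.iterate_succ_apply']

theorem hasDerivAt_sum_eval_mul_exp {ι : Type*} [Fintype ι] (q a : ι → ℝ[X]) (x : ℝ) :
    HasDerivAt (fun x => ∑ i, (a i).eval x * Real.exp ((q i).eval x))
      (∑ i, (derivative (a i) + derivative (q i) * a i).eval x * Real.exp ((q i).eval x)) x := by
  refine HasDerivAt.fun_sum fun i _ => ?_
  refine (((a i).hasDerivAt x).mul ((q i).hasDerivAt x).exp).congr_deriv ?_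
  simp only [eval_add, eval_mul]
  ring

theorem iteratedDeriv_sum_exp {ι : Type*} [Fintype ι] (q : ι → ℝ[X]) (c : ι → ℝ) (k : ℕ) :
    iteratedDeriv k (fun x => ∑ i, c i * Real.exp ((q i).eval x)) =
      fun x => ∑ i, (C (c i) * expDerivCoeff (q i) k).eval x * Real.exp ((q i).eval x) := by
  induction k with
  | zero => simp [expDerivCoeff_zero]
  | succ k ih =>
    rw [iteratedDeriv_succ, ih]
    funext x
    rw [(hasDerivAt_sum_eval_mul_exp q _ x).deriv]
    refine Finset.sum_congr rfl fun i _ => ?_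
    rw [expDerivCoeff_succ]
    simp only [eval_add, eval_mul, derivative_mul, derivative_C, eval_C, zero_mul, zero_add]
    ring

/-- The logarithmic derivative of a nonzero rational function is not a nonzero polynomial. -/
theorem mul_derivative_sub_ne {a b d : ℝ[X]} (ha : a ≠ 0) (hb : b ≠ 0) (hd : d ≠ 0) :
    a * derivative b - b * derivative a ≠ d * (a * b) := by
  intro h
  have h1 : (a * derivative b - b * derivative a).degree < (a * b).degree := by
    refine (degree_sub_le _ _).trans_lt (max_lt ?_ ?_)
    · rw [degree_mul, degree_mul]
      exact WithBot.add_lt_add_left (degree_ne_bot.2 ha) (degree_derivative_lt hb)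
    · rw [mul_comm a b, degree_mul, degree_mul]
      exact WithBot.add_lt_add_left (degree_ne_bot.2 hb) (degree_derivative_lt ha)
  rw [h] at h1
  exact h1.not_ge (degree_le_mul_left _ hd |>.trans (by rw [mul_comm]))

/-- A decreasing chain of spaces of tuples, stepped down by the conjugates of the derivative by `exp q`,
contains only zero at the level given by the size of the support, provided the `q i` have distinct
derivatives. -/
theorem eq_zero_of_mem_twisted_chain {ι : Type*} [DecidableEq ι] (q : ι → ℝ[X])
    (hq : Function.Injective fun i => derivative (q i))
    (W : ℕ → Submodule ℝ[X] (ι → ℝ[X])) (hW : Antitone W)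
    (hD : ∀ k, ∀ a ∈ W (k + 1), (fun i => derivative (a i) + derivative (q i) * a i) ∈ W k)
    (hsingle : ∀ a ∈ W 1, ∀ i, (∀ j, j ≠ i → a j = 0) → a i = 0) (s : Finset ι) :
    ∀ a ∈ W s.card, (∀ i, i ∉ s → a i = 0) → a = 0 := by
  induction s using Finset.induction_on with
  | empty => exact fun a _ h => funext fun i => h i (Finset.notMem_empty i)
  | insert i₀ s hi₀ ih =>
    intro a ha hsupp
    rw [Finset.card_insert_of_notMem hi₀] at ha
    by_cases h0 : a i₀ = 0
    · refine ih a (hW (Nat.le_succ _) ha) fun i hi => ?_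
      by_cases hii : i = i₀
      · rw [hii, h0]
      · exact hsupp i (by simp [hii, hi])
    · exfalso
      have hb := ih (a i₀ • (fun i => derivative (a i) + derivative (q i) * a i)
          - (derivative (a i₀) + derivative (q i₀) * a i₀) • a)
        (sub_mem (Submodule.smul_mem _ _ (hD _ a ha))
          (Submodule.smul_mem _ _ (hW (Nat.le_succ _) ha))) (by
          intro i hi
          simp only [Pi.sub_apply, Pi.smul_apply, smul_eq_mul]
          by_cases hii : i = i₀
          · rw [hii]; ring
          · rw [hsupp i (by simp [hii, hi])]; simp)
      refine h0 (hsingle a (hW (by omega) ha) i₀ fun i hi => ?_)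
      by_contra hai
      have hbi := congrFun hb i
      simp only [Pi.sub_apply, Pi.smul_apply, smul_eq_mul, Pi.zero_apply] at hbi
      refine mul_derivative_sub_ne h0 hai (sub_ne_zero.2 (hq.ne hi.symm)) ?_
      linear_combination hbi

theorem eq_zero_of_sum_eval_mul_exp_eq_zero {ι : Type*} [Fintype ι] (q : ι → ℝ[X])
    (hq : Function.Injective fun i => derivative (q i)) (a : ι → ℝ[X])
    (h : ∀ x : ℝ, ∑ i, (a i).eval x * Real.exp ((q i).eval x) = 0) : a = 0 := by
  classical
  let V : Submodule ℝ[X] (ι → ℝ[X]) :=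
    { carrier := {a | ∀ x : ℝ, ∑ i, (a i).eval x * Real.exp ((q i).eval x) = 0}
      add_mem' := fun {a b} ha hb x => by
        simp [add_mul, Finset.sum_add_distrib, ha x, hb x]
      zero_mem' := fun x => by simp
      smul_mem' := fun r a ha x => by
        simp [mul_assoc, ← Finset.mul_sum, ha x] }
  refine eq_zero_of_mem_twisted_chain q hq (fun _ => V) antitone_const ?_ ?_ Finset.univ a h
    (by simp)
  · intro _ b hb x
    rw [← (hasDerivAt_sum_eval_mul_exp q b x).deriv, funext hb]
    simp
  · intro b hb i hi
    refine Polynomial.funext fun x => ?_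
    have hx := hb x
    rw [Finset.sum_eq_single i (fun j _ hj => by simp [hi j hj]) (by simp)] at hx
    simpa [Real.exp_ne_zero] using hx

theorem eq_zero_of_sum_mul_expDerivCoeff_eq_zero {ι : Type*} [Fintype ι] (q : ι → ℝ[X])
    (hq : Function.Injective fun i => derivative (q i)) (a : ι → ℝ[X])
    (h : ∀ k < Fintype.card ι, ∑ i, a i * expDerivCoeff (q i) k = 0) : a = 0 := by
  classical
  let W : ℕ → Submodule ℝ[X] (ι → ℝ[X]) := fun n =>
    { carrier := {a | ∀ k < n, ∑ i, a i * expDerivCoeff (q i) k = 0}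
      add_mem' := fun {a b} ha hb k hk => by
        simp [add_mul, Finset.sum_add_distrib, ha k hk, hb k hk]
      zero_mem' := fun k _ => by simp
      smul_mem' := fun r a ha k hk => by
        simp [mul_assoc, ← Finset.mul_sum, ha k hk] }
  refine eq_zero_of_mem_twisted_chain (fun i => -q i)
    (fun i j hij => hq (by simpa using hij)) W
    (fun m n hmn b hb k hk => hb k (hk.trans_le hmn)) ?_ ?_ Finset.univ a h (by simp)
  · intro n b hb k hk
    have h1 := congrArg derivative (hb k (hk.trans n.lt_succ_self))
    have h2 := hb (k + 1) (Nat.succ_lt_succ hk)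
    simp only [derivative_sum, derivative_mul, derivative_zero] at h1
    simp only [expDerivCoeff_succ] at h2
    rw [← sub_zero (0 : ℝ[X])]
    nth_rewrite 1 [← h1]
    rw [← h2, ← Finset.sum_sub_distrib]
    refine Finset.sum_congr rfl fun i _ => ?_
    simp only [derivative_neg]
    ring
  · intro b hb i hi
    have h0 := hb 0 one_pos
    rw [Finset.sum_eq_single i (fun j _ hj => by simp [hi j hj]) (by simp)] at h0
    simpa [expDerivCoeff_zero] using h0

theorem sum_eval_mul_iteratedDeriv_sum_exp {ι : Type*} [Fintype ι] (q : ι → ℝ[X]) (c : ι → ℝ)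
    (p : ℕ → ℝ[X]) (n : ℕ) (x : ℝ) :
    ∑ k ∈ Finset.range n, (p k).eval x *
        iteratedDeriv k (fun x => ∑ i, c i * Real.exp ((q i).eval x)) x =
      ∑ i, (C (c i) * ∑ k ∈ Finset.range n, p k * expDerivCoeff (q i) k).eval x *
        Real.exp ((q i).eval x) := by
  simp only [iteratedDeriv_sum_exp, Finset.mul_sum, eval_finsetSum, Finset.sum_mul]
  rw [Finset.sum_comm]
  refine Finset.sum_congr rfl fun i _ => Finset.sum_congr rfl fun k _ => ?_
  simp only [eval_mul]
  ring

theorem simpleDE_sum_exp (N : ℕ) (q : Fin N → ℝ[X]) (c : Fin N → ℝ) :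
    SimpleDE (fun x => ∑ i, c i * Real.exp ((q i).eval x)) N Set.univ := by
  let M : Matrix (Fin (N + 1)) (Fin (N + 1)) ℝ[X] :=
    Fin.snoc (α := fun _ => Fin (N + 1) → ℝ[X]) (fun i k => expDerivCoeff (q i) k) 0
  have hM : M.det = 0 :=
    Matrix.det_eq_zero_of_row_eq_zero (Fin.last N) fun j => by simp [M]
  obtain ⟨v, hv, hMv⟩ := Matrix.exists_mulVec_eq_zero_iff.2 hM
  obtain ⟨k₀, hk₀⟩ := Function.ne_iff.1 hv
  refine ⟨fun k => if h : k < N + 1 then v ⟨k, h⟩ else 0,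
    ⟨k₀, Nat.lt_succ_iff.1 k₀.2, by simpa [Nat.lt_succ_iff.1 k₀.2] using hk₀⟩, fun x _ => ?_⟩
  rw [sum_eval_mul_iteratedDeriv_sum_exp]
  refine Finset.sum_eq_zero fun i _ => ?_
  have hi := congrFun hMv i.castSucc
  simp only [M, Matrix.mulVec, dotProduct, Fin.snoc_castSucc, Pi.zero_apply] at hi
  rw [Finset.sum_range]
  simp only [Fin.is_lt, dite_true, Fin.eta]
  simp_rw [mul_comm (v _)]
  simp [hi]

theorem exactOrder_sum_exp (N : ℕ) (hN : 1 ≤ N) (q : Fin N → ℝ[X])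
    (hq : Function.Injective fun i => derivative (q i)) (c : Fin N → ℝ) (hc : ∀ i, c i ≠ 0) :
    ExactOrder (fun x => ∑ i, c i * Real.exp ((q i).eval x)) N Set.univ := by
  refine ⟨simpleDE_sum_exp N q c, ?_⟩
  rintro ⟨p, ⟨k₀, hk₀, hp⟩, h⟩
  rw [Nat.sub_add_cancel hN] at h
  have hcol := eq_zero_of_sum_eval_mul_exp_eq_zero q hq _ fun x =>
    (sum_eval_mul_iteratedDeriv_sum_exp q c p N x).symm.trans (h x (Set.mem_univ x))
  let M : Matrix (Fin N) (Fin N) ℝ[X] := fun i k => expDerivCoeff (q i) k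
  have hM : M.det = 0 := by
    refine Matrix.exists_mulVec_eq_zero_iff.1 ⟨fun k => p k, ?_, ?_⟩
    · exact Function.ne_iff.2 ⟨⟨k₀, by omega⟩, hp⟩
    · funext i
      have hi := congrFun hcol i
      simp only [Pi.zero_apply, mul_eq_zero, C_eq_zero, hc i, false_or, Finset.sum_range] at hi
      simpa [M, Matrix.mulVec, dotProduct, mul_comm] using hi
  obtain ⟨v, hv, hvM⟩ := Matrix.exists_vecMul_eq_zero_iff.2 hM
  refine hv (eq_zero_of_sum_mul_expDerivCoeff_eq_zero q hq v fun k hk => ?_)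
  exact congrFun hvM ⟨k, by simpa using hk⟩

theorem exactOrder_finset_sum_exp {ι : Type*} (s : Finset ι) (hs : s.Nonempty) (q : ι → ℝ[X])
    (hq : Set.InjOn (fun i => derivative (q i)) s) (c : ι → ℝ) (hc : ∀ i ∈ s, c i ≠ 0) :
    ExactOrder (fun x => ∑ i ∈ s, c i * Real.exp ((q i).eval x)) s.card Set.univ := by
  let e := s.equivFin.symm
  convert exactOrder_sum_exp s.card hs.card_pos (fun i => q (e i))
    (fun i j hij => e.injective (Subtype.ext (hq (e i).2 (e j).2 hij)))
    (fun i => c (e i)) (fun i => hc _ (e i).2) using 2 with x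
  rw [e.sum_comp (fun i : s => c i * Real.exp ((q i).eval x)),
    Finset.sum_coe_sort s fun i => c i * Real.exp ((q i).eval x)]

theorem eq_of_derivative_eq_of_coeff_zero_eq {p q : ℝ[X]} (h : derivative p = derivative q)
    (h0 : p.coeff 0 = q.coeff 0) : p = q := by
  ext m
  cases m with
  | zero => exact h0
  | succ m =>
    have hm := congrArg (fun r => r.coeff m) h
    simp only [coeff_derivative] at hm
    exact mul_right_cancel₀ (by positivity) hm

/-- The polynomial `X ^ i + X ^ j` attached to the unordered pair `{i, j}`. -/
noncomputable def sym2PowSum (z : Sym2 ℕ) : ℝ[X] :=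
  Sym2.lift ⟨fun i j => X ^ i + X ^ j, fun _ _ => add_comm _ _⟩ z

theorem sym2PowSum_mk (i j : ℕ) : sym2PowSum s(i, j) = X ^ i + X ^ j := rfl

theorem sym2PowSum_injective : Function.Injective sym2PowSum := by
  intro y z
  induction y using Sym2.ind with | _ i j
  induction z using Sym2.ind with | _ k l
  intro h
  have hm : ∀ m, (if m = i then (1 : ℝ) else 0) + (if m = j then 1 else 0) =
      (if m = k then 1 else 0) + (if m = l then 1 else 0) := fun m => by
    simpa [sym2PowSum_mk, Polynomial.coeff_X_pow] using congrArg (fun r => r.coeff m) h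
  have hi := hm i
  have hj := hm j
  have hk := hm k
  rw [Sym2.eq_iff]
  grind

theorem derivative_sym2PowSum_injOn (n : ℕ) :
    Set.InjOn (fun z => derivative (sym2PowSum z)) ((Finset.Icc 1 n).sym2 : Set (Sym2 ℕ)) := by
  have h0 : ∀ z ∈ (Finset.Icc 1 n).sym2, (sym2PowSum z).coeff 0 = 0 := by
    intro z
    induction z using Sym2.ind with | _ i j
    intro hz
    simp only [Finset.mk_mem_sym2_iff, Finset.mem_Icc] at hz
    simp only [sym2PowSum_mk, coeff_add, coeff_X_pow]
    rw [if_neg (by omega), if_neg (by omega), add_zero]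
  exact fun y hy z hz h => sym2PowSum_injective
    (eq_of_derivative_eq_of_coeff_zero_eq h ((h0 y hy).trans (h0 z hz).symm))

theorem sq_sum_exp_pow (n : ℕ) (x : ℝ) :
    (∑ k ∈ Finset.Icc 1 n, Real.exp (x ^ k)) ^ 2 =
      ∑ z ∈ (Finset.Icc 1 n).sym2,
        ((((Finset.Icc 1 n) ×ˢ (Finset.Icc 1 n)).filter fun a => s(a.1, a.2) = z).card : ℝ) *
          Real.exp ((sym2PowSum z).eval x) := by
  have hmaps : ∀ a ∈ (Finset.Icc 1 n) ×ˢ (Finset.Icc 1 n),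
      s(a.1, a.2) ∈ (Finset.Icc 1 n).sym2 := fun a ha => by
    rw [Finset.mk_mem_sym2_iff]
    exact Finset.mem_product.1 ha
  rw [sq, Finset.sum_mul_sum, ← Finset.sum_product', ← Finset.sum_fiberwise_of_maps_to hmaps]
  refine Finset.sum_congr rfl fun z _ => ?_
  rw [← nsmul_eq_mul, ← Finset.sum_const]
  refine Finset.sum_congr rfl fun a ha => ?_
  rw [← (Finset.mem_filter.1 ha).2, sym2PowSum_mk, ← Real.exp_add]
  simp

end

theorem sharp_square (n : ℕ) (hn : 1 ≤ n) :
    ExactOrder (fun x : ℝ => ∑ k ∈ Finset.Icc 1 n, Real.exp (x ^ k)) n Set.univ ∧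
    ExactOrder (fun x : ℝ => (∑ k ∈ Finset.Icc 1 n, Real.exp (x ^ k)) ^ 2)
      (n * (n + 1) / 2) Set.univ := by
  have hne : (Finset.Icc 1 n).Nonempty := Finset.nonempty_Icc.2 hn
  constructor
  · have h := exactOrder_finset_sum_exp (Finset.Icc 1 n) hne (fun k => Polynomial.X ^ k)
      (fun i hi j hj hij => by
        simp only [Finset.coe_Icc, Set.mem_Icc] at hi hj
        have hX : (Polynomial.X ^ i : Polynomial ℝ) = Polynomial.X ^ j :=
          eq_of_derivative_eq_of_coeff_zero_eq hij (by
            simp only [Polynomial.coeff_X_pow]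
            rw [if_neg (by omega), if_neg (by omega)])
        simpa using congrArg Polynomial.natDegree hX)
      (fun _ => 1) (fun _ _ => one_ne_zero)
    simpa using h
  · have h := exactOrder_finset_sum_exp (Finset.Icc 1 n).sym2 (Finset.sym2_nonempty.2 hne)
      sym2PowSum (derivative_sym2PowSum_injOn n)
      (fun z => ((((Finset.Icc 1 n) ×ˢ (Finset.Icc 1 n)).filter
        fun a => s(a.1, a.2) = z).card : ℝ))
      (fun z hz => by
        induction z using Sym2.ind with | _ i j
        rw [Finset.mk_mem_sym2_iff] at hz
        exact Nat.cast_ne_zero.2 (Finset.card_ne_zero_of_mem (a := (i, j))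
          (Finset.mem_filter.2 ⟨Finset.mem_product.2 hz, rfl⟩)))
    rw [Finset.card_sym2, Nat.card_Icc, Nat.add_sub_cancel, Nat.choose_two_right,
      Nat.add_sub_cancel, mul_comm] at h
    simpa only [sq_sum_exp_pow] using h
end
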